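/- Let q = p^m be a prime power, n = q + 2, and w = (2, 3, …, q+1, 2, q+1) ∈ 𝒮_n. Then H_k⟦w⟧ ≅ ℤ/qℤ if k = q, and H_k⟦w⟧ = 0 if k ≠ q. Consequently, for every n with p^m < n − 1, H_{p^m}(𝔫𝔦𝔩_n; ℤ) contains a direct summand isomorphic to ℤ/p^mℤ. -/

import Mathlib

namespace Nil

/-- Index pairs `(a,b)` with `a < b` in `Fin n`, indexing the basis `e_{ab}` of `nil_n`. -/
abbrev P (n : ℕ) : Type := {p : Fin n × Fin n // p.1 < p.2}

/-- Lexicographic key of a pair. -/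
def key {n : ℕ} (p : P n) : ℕ := p.1.1.1 * n + p.1.2.1

/-- Position (0-based) of `a` in the lexicographically sorted list of `M`. -/
def pos {n : ℕ} (M : Finset (P n)) (a : P n) : ℕ :=
  (M.filter fun b => key b < key a).card

/-- Basis of the degree `k` part of the Chevalley-Eilenberg complex `Λ^* nil_n`:
subsets `M` of pairs with `|M| = k` (empty for `k < 0`). -/
abbrev B (n : ℕ) (k : ℤ) : Type := {M : Finset (P n) // (M.card : ℤ) = k}

/-- Degree `k` chain group of the Chevalley-Eilenberg complex of `nil_n`. -/
abbrev C (n : ℕ) (k : ℤ) : Type := B n k →₀ ℤ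

/-- The Chevalley-Eilenberg boundary of a basis wedge `e_M`:
`∂(e_{a₁b₁} ∧ … ∧ e_{aₖbₖ}) = Σ_{i<j} (-1)^{i+j} [e_{aᵢbᵢ}, e_{aⱼbⱼ}] ∧ …` (omitting
the i-th and j-th factors), written in the lexicographically sorted basis.
For lexicographically sorted wedges the only nonzero brackets come from pairs
`a = (x,y)`, `b = (y,z)`, producing `±e_{(x,z)}`. -/
noncomputable def dAux {n : ℕ} (k : ℤ) (M : Finset (P n)) : C n k :=
  ∑ a ∈ M, ∑ b ∈ M,
    if hab : a.1.2 = b.1.1 then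
      (let c : P n := ⟨(a.1.1, b.1.2), lt_trans a.2 (by rw [hab]; exact b.2)⟩
       let M' : Finset (P n) := insert c ((M.erase a).erase b)
       if h' : (M'.card : ℤ) = k then
         ((-1 : ℤ) ^ (pos M a + pos M b + pos M' c)) • Finsupp.single (⟨M', h'⟩ : B n k) 1
       else 0)
    else 0

/-- The Chevalley-Eilenberg boundary map in degree `k+1`. -/
noncomputable def d (n : ℕ) (k : ℤ) : C n (k + 1) →ₗ[ℤ] C n k :=
  Finsupp.lsum ℤ fun M => LinearMap.toSpanSingleton ℤ (C n k) (dAux k M.1)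

/-- Degree-cast isomorphism. -/
noncomputable def castC (n : ℕ) {k l : ℤ} (h : k = l) : C n k ≃ₗ[ℤ] C n l :=
  Finsupp.domLCongr (Equiv.subtypeEquivRight fun _ => by rw [h])

/-- The boundary map out of degree `k`. -/
noncomputable def dFrom (n : ℕ) (k : ℤ) : C n k →ₗ[ℤ] C n (k - 1) :=
  (d n (k - 1)).comp (castC n (by ring : k = k - 1 + 1)).toLinearMap

/-- Cycles of `Λ^* nil_n` in degree `k`. -/
noncomputable def Zfull (n : ℕ) (k : ℤ) : Submodule ℤ (C n k) := LinearMap.ker (dFrom n k)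

noncomputable def HnilSub (n : ℕ) (k : ℤ) : Submodule ℤ (Zfull n k) :=
  Submodule.comap (Zfull n k).subtype (LinearMap.range (d n k) ⊓ Zfull n k)

/-- `H_k(nil_n; ℤ)`: the `k`-th integral homology of the Chevalley-Eilenberg complex
of the Lie ring of strictly upper triangular `n × n` integer matrices. -/
noncomputable def Hnil (n : ℕ) (k : ℤ) : Type := Zfull n k ⧸ HnilSub n k

noncomputable instance (n : ℕ) (k : ℤ) : AddCommGroup (Hnil n k) :=
  inferInstanceAs (AddCommGroup (Zfull n k ⧸ HnilSub n k))

noncomputable instance (n : ℕ) (k : ℤ) : Module ℤ (Hnil n k) :=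
  inferInstanceAs (Module ℤ (Zfull n k ⧸ HnilSub n k))

/-- The modified weight of a basis wedge `e_M` (indices of `Fin n` are 0-based, so the
`i`-th weight of the paper, `1 ≤ i ≤ n`, is `wt M ⟨i-1,_⟩`):
`w_i(e_M) = i - #{x : (x,i) ∈ M} + #{y : (i,y) ∈ M}`. -/
def wt {n : ℕ} (M : Finset (P n)) : Fin n → ℤ := fun i =>
  ((i.1 : ℤ) + 1) - (M.filter fun p => p.1.2 = i).card + (M.filter fun p => p.1.1 = i).card

/-- Basis wedges of degree `k` and modified weight `w`. -/
abbrev Bw (n : ℕ) (k : ℤ) (w : Fin n → ℤ) : Type :=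
  {M : Finset (P n) // (M.card : ℤ) = k ∧ wt M = w}

/-- Degree `k` part of the weight summand `⟦w⟧` of `Λ^* nil_n`. -/
abbrev Cw (n : ℕ) (k : ℤ) (w : Fin n → ℤ) : Type := Bw n k w →₀ ℤ

/-- Inclusion of the weight summand. -/
noncomputable def inclW (n : ℕ) (k : ℤ) (w : Fin n → ℤ) : Cw n k w →ₗ[ℤ] C n k :=
  Finsupp.lmapDomain ℤ ℤ fun M => (⟨M.1, M.2.1⟩ : B n k)

/-- Projection onto the weight summand. -/
noncomputable def projW (n : ℕ) (k : ℤ) (w : Fin n → ℤ) : C n k →ₗ[ℤ] Cw n k w :=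
  Finsupp.lsum ℤ fun M =>
    if h : wt M.1 = w then
      LinearMap.toSpanSingleton ℤ (Cw n k w) (Finsupp.single (⟨M.1, M.2, h⟩ : Bw n k w) 1)
    else 0

/-- The boundary of the weight summand `⟦w⟧` (the boundary preserves weights, so this
is the restriction of the Chevalley-Eilenberg boundary). -/
noncomputable def dW (n : ℕ) (k : ℤ) (w : Fin n → ℤ) : Cw n (k + 1) w →ₗ[ℤ] Cw n k w :=
  (projW n k w) ∘ₗ (d n k) ∘ₗ (inclW n (k + 1) w)

noncomputable def castCw (n : ℕ) (w : Fin n → ℤ) {k l : ℤ} (h : k = l) :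
    Cw n k w ≃ₗ[ℤ] Cw n l w :=
  Finsupp.domLCongr (Equiv.subtypeEquivRight fun _ => by rw [h])

noncomputable def dFromW (n : ℕ) (k : ℤ) (w : Fin n → ℤ) : Cw n k w →ₗ[ℤ] Cw n (k - 1) w :=
  (dW n (k - 1) w).comp (castCw n w (by ring : k = k - 1 + 1)).toLinearMap

noncomputable def ZW (n : ℕ) (k : ℤ) (w : Fin n → ℤ) : Submodule ℤ (Cw n k w) :=
  LinearMap.ker (dFromW n k w)

noncomputable def HwSub (n : ℕ) (k : ℤ) (w : Fin n → ℤ) : Submodule ℤ (ZW n k w) :=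
  Submodule.comap (ZW n k w).subtype (LinearMap.range (dW n k w) ⊓ ZW n k w)

/-- `H_k⟦w⟧`: the `k`-th homology of the weight summand `⟦w⟧` of `Λ^* nil_n`. -/
noncomputable def Hw (n : ℕ) (k : ℤ) (w : Fin n → ℤ) : Type := ZW n k w ⧸ HwSub n k w

noncomputable instance (n : ℕ) (k : ℤ) (w : Fin n → ℤ) : AddCommGroup (Hw n k w) :=
  inferInstanceAs (AddCommGroup (ZW n k w ⧸ HwSub n k w))

noncomputable instance (n : ℕ) (k : ℤ) (w : Fin n → ℤ) : Module ℤ (Hw n k w) :=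
  inferInstanceAs (Module ℤ (ZW n k w ⧸ HwSub n k w))

/-- `w ∈ 𝒮_n`: all entries lie in `{1,…,n}` and they add up to `binom (n+1) 2`. -/
def Sn (n : ℕ) (w : Fin n → ℤ) : Prop :=
  (∀ i, 1 ≤ w i ∧ w i ≤ (n : ℤ)) ∧ 2 * ∑ i, w i = (n : ℤ) * ((n : ℤ) + 1)

/-- Number of inversions of a permutation of `Fin n`. -/
def invCount (n : ℕ) (π : Equiv.Perm (Fin n)) : ℕ :=
  (Finset.univ.filter fun p : Fin n × Fin n => p.1 < p.2 ∧ π p.2 < π p.1).card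

/-- The weight sequence `(π(1), …, π(n))` attached to a permutation (1-based values). -/
def permWt (n : ℕ) (π : Equiv.Perm (Fin n)) : Fin n → ℤ := fun i => ((π i).1 : ℤ) + 1

/-- The set of inversions of a permutation, as a set of index pairs. -/
def invFinset {n : ℕ} (π : Equiv.Perm (Fin n)) : Finset (P n) :=
  Finset.univ.filter fun p => π p.1.2 < π p.1.1

/-- Index reversal `i ↦ n+1-i` (0-based: `i ↦ n-1-i`). -/
def rev {n : ℕ} (i : Fin n) : Fin n := ⟨n - 1 - i.1, by have := i.isLt; omega⟩


/-- The weight sequence `w = (2, 3, …, q+1, 2, q+1)` of length `q + 2`. -/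
def wq (q : ℕ) : Fin (q + 2) → ℤ := fun i =>
  if i.1 < q then (i.1 : ℤ) + 2 else if i.1 = q then 2 else (q : ℤ) + 1

variable {n : ℕ}

lemma key_injective : Function.Injective (key (n := n)) := by
  rintro ⟨⟨a, b⟩, h⟩ ⟨⟨c, e⟩, h'⟩ hk
  have hb := b.isLt
  have he := e.isLt
  simp only [key] at hk
  have h1 : a.1 = c.1 := by
    have := congrArg (· / n) hk
    simpa [Nat.add_div_of_dvd_right, Nat.mul_add_div, Nat.div_eq_of_lt hb, Nat.div_eq_of_lt he,
      Nat.mul_comm _ n, (by omega : 0 < n)] using this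
  have h2 : b.1 = e.1 := by rw [h1] at hk; omega
  simp [Fin.ext_iff, h1, h2]

lemma key_lt_of_fst_lt {a b : P n} (h : a.1.1 < b.1.1) : key a < key b := by
  have h1 : a.1.1.1 + 1 ≤ b.1.1.1 := h
  have h2 := a.1.2.isLt
  have := Nat.mul_le_mul_right n h1
  simp only [key]
  nlinarith

lemma key_lt_iff {a b : P n} :
    key a < key b ↔ a.1.1 < b.1.1 ∨ a.1.1 = b.1.1 ∧ a.1.2 < b.1.2 := by
  constructor
  · intro h
    rcases lt_trichotomy a.1.1 b.1.1 with h1 | h1 | h1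
    · exact Or.inl h1
    · refine Or.inr ⟨h1, ?_⟩
      simp only [key, h1] at h
      exact Fin.lt_def.2 (by omega)
    · exact absurd h (key_lt_of_fst_lt h1).le.not_gt
  · rintro (h | ⟨h1, h2⟩)
    · exact key_lt_of_fst_lt h
    · simp only [key, h1]
      have := Fin.lt_def.1 h2
      omega

/-! ### Creation and annihilation operators -/

/-- The sign `(-1) ^ pos M a`. -/
def sg (M : Finset (P n)) (a : P n) : ℤ := (-1) ^ pos M a

/-- The sign relating the positions of `b` before and after `a` is added or removed. -/
def tau (a b : P n) : ℤ := if key a < key b then -1 else 1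

lemma tau_swap {a b : P n} (h : a ≠ b) : tau a b = -tau b a := by
  have : key a ≠ key b := fun h' => h (key_injective h')
  unfold tau
  rcases lt_or_gt_of_ne this with h | h
  · simp [h, h.le.not_gt]
  · simp [h, h.le.not_gt]

lemma tau_mul_self (a b : P n) : tau a b * tau a b = 1 := by
  unfold tau; split_ifs <;> rfl

lemma sg_mul_self (M : Finset (P n)) (a : P n) : sg M a * sg M a = 1 := by
  unfold sg; rw [← pow_add, ← two_mul, pow_mul]; simp

lemma sg_insert {M : Finset (P n)} {a : P n} (ha : a ∉ M) (b : P n) :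
    sg (insert a M) b = tau a b * sg M b := by
  unfold sg pos tau
  rw [Finset.filter_insert]
  split_ifs with h
  · rw [Finset.card_insert_of_notMem (by simp [ha]), pow_succ]; ring
  · simp

lemma sg_erase {M : Finset (P n)} {a : P n} (ha : a ∈ M) (b : P n) :
    sg (M.erase a) b = tau a b * sg M b := by
  have h := sg_insert (Finset.notMem_erase a M) b
  rw [Finset.insert_erase ha] at h
  rw [h, ← mul_assoc, tau_mul_self, one_mul]

/-- Transpose of the contraction by the dual basis vector of `a`. -/
def ann (a : P n) : Module.End ℤ (Finset (P n) → ℤ) where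
  toFun f M := if a ∈ M then sg M a * f (M.erase a) else 0
  map_add' f g := by ext M; simp only [Pi.add_apply]; split_ifs <;> ring
  map_smul' r f := by
    ext M; simp only [Pi.smul_apply, smul_eq_mul, RingHom.id_apply]; split_ifs <;> ring

/-- Transpose of the wedge product with `e_a`. -/
def cre (a : P n) : Module.End ℤ (Finset (P n) → ℤ) where
  toFun f M := if a ∈ M then 0 else sg M a * f (insert a M)
  map_add' f g := by ext M; simp only [Pi.add_apply]; split_ifs <;> ring
  map_smul' r f := by
    ext M; simp only [Pi.smul_apply, smul_eq_mul, RingHom.id_apply]; split_ifs <;> ring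

lemma ann_apply (a : P n) (f : Finset (P n) → ℤ) (M : Finset (P n)) :
    ann a f M = if a ∈ M then sg M a * f (M.erase a) else 0 := rfl

lemma cre_apply (a : P n) (f : Finset (P n) → ℤ) (M : Finset (P n)) :
    cre a f M = if a ∈ M then 0 else sg M a * f (insert a M) := rfl

lemma ann_mul_ann (a b : P n) : ann a * ann b = -(ann b * ann a) := by
  refine LinearMap.ext fun f => funext fun M => ?_
  simp only [Module.End.mul_apply, LinearMap.neg_apply, Pi.neg_apply, ann_apply]
  by_cases hab : a = b
  · subst hab; simp
  by_cases ha : a ∈ M <;> by_cases hb : b ∈ M <;>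
    simp only [ha, hb, Finset.mem_erase, hab, Ne.symm hab, ne_eq, not_false_eq_true, true_and,
      if_true, if_false, mul_zero, neg_zero, and_false]
  rw [sg_erase ha, sg_erase hb, Finset.erase_right_comm, tau_swap hab]
  ring

lemma cre_mul_cre (a b : P n) : cre a * cre b = -(cre b * cre a) := by
  refine LinearMap.ext fun f => funext fun M => ?_
  simp only [Module.End.mul_apply, LinearMap.neg_apply, Pi.neg_apply, cre_apply]
  by_cases hab : a = b
  · subst hab; simp
  by_cases ha : a ∈ M <;> by_cases hb : b ∈ M <;>
    simp only [ha, hb, Finset.mem_insert, hab, Ne.symm hab, or_true, or_self,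
      if_true, if_false, mul_zero, neg_zero]
  rw [sg_insert ha, sg_insert hb, Finset.insert_comm, tau_swap hab]
  ring

lemma cre_mul_ann (a b : P n) :
    cre a * ann b = -(ann b * cre a) + if a = b then 1 else 0 := by
  refine LinearMap.ext fun f => funext fun M => ?_
  simp only [Module.End.mul_apply, LinearMap.add_apply, LinearMap.neg_apply, Pi.add_apply,
    Pi.neg_apply, cre_apply, ann_apply]
  by_cases hab : a = b
  · subst hab
    by_cases ha : a ∈ M
    · simp only [ha, if_true, Finset.notMem_erase, if_false, Finset.insert_erase,
        Module.End.one_apply, sg_erase, tau, lt_irrefl, one_mul]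
      linear_combination (f M) * sg_mul_self M a
    · simp only [ha, if_true, if_false, Finset.mem_insert_self, Finset.erase_insert,
        not_false_eq_true, Module.End.one_apply, sg_insert, tau, lt_irrefl, one_mul]
      linear_combination (f M) * sg_mul_self M a
  · by_cases ha : a ∈ M <;> by_cases hb : b ∈ M <;>
      simp only [ha, hb, Finset.mem_insert, Finset.mem_erase, hab, Ne.symm hab, or_false, or_true,
        ne_eq, not_false_eq_true, true_and, and_false, if_true, if_false, mul_zero, neg_zero,
        LinearMap.zero_apply, Pi.zero_apply, add_zero]
    rw [sg_insert ha, sg_erase hb, Finset.erase_insert_of_ne hab, tau_swap hab]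
    ring

/-- `ann` extended by zero to all pairs of indices. -/
def annP (x y : Fin n) : Module.End ℤ (Finset (P n) → ℤ) :=
  if h : x < y then ann ⟨(x, y), h⟩ else 0

/-- `cre` extended by zero to all pairs of indices. -/
def creP (x y : Fin n) : Module.End ℤ (Finset (P n) → ℤ) :=
  if h : x < y then cre ⟨(x, y), h⟩ else 0

lemma annP_mul_annP (x y z t : Fin n) : annP x y * annP z t = -(annP z t * annP x y) := by
  unfold annP
  split_ifs <;> first | exact ann_mul_ann _ _ | simp

lemma annP_mul_annP_mul_annP (x y z t r s : Fin n) :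
    annP x y * (annP z t * annP r s) = annP z t * annP r s * annP x y := by
  rw [← mul_assoc, annP_mul_annP x y, neg_mul, mul_assoc, annP_mul_annP x y, mul_neg, neg_neg,
    mul_assoc]

lemma creP_mul_creP (x y z t : Fin n) : creP x y * creP z t = -(creP z t * creP x y) := by
  unfold creP
  split_ifs <;> first | exact cre_mul_cre _ _ | simp

lemma creP_mul_annP (x y z t : Fin n) :
    creP x y * annP z t =
      -(annP z t * creP x y) + if x = z then if y = t then if x < y then 1 else 0 else 0 else 0 := by
  unfold creP annP
  by_cases h1 : x < y <;> by_cases h2 : z < t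
  · simp only [h1, h2, dif_pos, cre_mul_ann, if_true]
    congr 1
    by_cases hx : x = z <;> by_cases hy : y = t <;> simp [hx, hy]
  · have h3 : ¬(x = z ∧ y = t) := by rintro ⟨rfl, rfl⟩; exact h2 h1
    simp only [h1, h2, dif_neg, not_false_eq_true, mul_zero, zero_mul, neg_zero, zero_add]
    rw [← ite_and, if_neg h3]
  · simp [h1]
  · simp [h1]

lemma ite_mul_annP (x y z : Fin n) :
    annP y z * annP x y * (if x < z then 1 else 0) = annP y z * annP x y := by
  unfold annP
  split_ifs with h1 h2 h3 <;> simp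
  exact absurd (lt_trans h2 h1) h3

/-- The transpose of the boundary written with creation and annihilation operators. -/
def opT (n : ℕ) : Module.End ℤ (Finset (P n) → ℤ) :=
  ∑ u : Fin n × Fin n × Fin n, annP u.2.1 u.2.2 * annP u.1 u.2.1 * creP u.1 u.2.2

lemma opT_mul_opT : opT n * opT n = 0 := by
  let K : Fin n × Fin n × Fin n → Module.End ℤ (Finset (P n) → ℤ) :=
    fun u => annP u.2.1 u.2.2 * annP u.1 u.2.1
  let E : Fin n × Fin n × Fin n → Module.End ℤ (Finset (P n) → ℤ) := fun u => creP u.1 u.2.2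
  let δ : Fin n → Fin n → Fin n → Fin n → Module.End ℤ (Finset (P n) → ℤ) :=
    fun x y z t => if x = z then if y = t then if x < y then 1 else 0 else 0 else 0
  have hKK : ∀ u v, K u * K v = K v * K u := by
    intro u v
    simp only [K]
    rw [mul_assoc, annP_mul_annP_mul_annP, ← mul_assoc, annP_mul_annP_mul_annP, mul_assoc]
  have hEK : ∀ u v, E u * K v = K v * E u - annP v.2.1 v.2.2 * δ u.1 u.2.2 v.1 v.2.1
      + δ u.1 u.2.2 v.2.1 v.2.2 * annP v.1 v.2.1 := by
    intro u v
    simp only [K, E, δ]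
    rw [← mul_assoc, creP_mul_annP, add_mul, neg_mul, mul_assoc, creP_mul_annP]
    noncomm_ring
  have h0 : ∑ u, ∑ v, K u * K v * (E u * E v) = 0 := by
    have h1 : ∑ u, ∑ v, K u * K v * (E u * E v) = -∑ u, ∑ v, K u * K v * (E u * E v) := by
      conv_lhs => rw [Finset.sum_comm]
      rw [← Finset.sum_neg_distrib]
      refine Finset.sum_congr rfl fun u _ => ?_
      rw [← Finset.sum_neg_distrib]
      refine Finset.sum_congr rfl fun v _ => ?_
      rw [hKK v u]
      simp only [E]
      rw [creP_mul_creP v.1, mul_neg]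
    have h2 : (2 : ℤ) • ∑ u, ∑ v, K u * K v * (E u * E v) = 0 := by
      rw [two_smul]; nth_rewrite 1 [h1]; simp
    exact (smul_eq_zero.1 h2).resolve_left two_ne_zero
  have h3 : opT n * opT n = ∑ u, ∑ v, K u * K v * (E u * E v)
      + ((∑ u, ∑ v, K u * (δ u.1 u.2.2 v.2.1 v.2.2 * annP v.1 v.2.1) * E v)
      - ∑ u, ∑ v, K u * (annP v.2.1 v.2.2 * δ u.1 u.2.2 v.1 v.2.1) * E v) := by
    simp only [opT]
    rw [Finset.sum_mul_sum, ← Finset.sum_sub_distrib, ← Finset.sum_add_distrib]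
    refine Finset.sum_congr rfl fun u _ => ?_
    rw [← Finset.sum_sub_distrib, ← Finset.sum_add_distrib]
    refine Finset.sum_congr rfl fun v _ => ?_
    have := hEK u v
    change K u * E u * (K v * E v) = _
    rw [mul_assoc, ← mul_assoc (E u), this]
    noncomm_ring
  rw [h3, h0, zero_add, sub_eq_zero]
  have h4 : ∑ u, ∑ v, K u * (δ u.1 u.2.2 v.2.1 v.2.2 * annP v.1 v.2.1) * E v
      = ∑ x, ∑ y, ∑ z, ∑ t, annP y z * annP x y * annP t x * creP t z := by
    simp only [Fintype.sum_prod_type, K, E, δ]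
    refine Finset.sum_congr rfl fun x _ => Finset.sum_congr rfl fun y _ =>
      Finset.sum_congr rfl fun z _ => Finset.sum_congr rfl fun t _ => ?_
    simp only [ite_mul, zero_mul, mul_ite, mul_zero, Finset.sum_ite_eq, Finset.mem_univ, if_true,
      Finset.sum_ite_irrel, Finset.sum_const_zero]
    rw [← ite_mul_annP x y z]
    split_ifs <;> simp [mul_assoc]
  have h5 : ∑ u, ∑ v, K u * (annP v.2.1 v.2.2 * δ u.1 u.2.2 v.1 v.2.1) * E v
      = ∑ x, ∑ y, ∑ z, ∑ t, annP y z * annP x y * annP z t * creP x t := by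
    simp only [Fintype.sum_prod_type, K, E, δ]
    refine Finset.sum_congr rfl fun x _ => Finset.sum_congr rfl fun y _ =>
      Finset.sum_congr rfl fun z _ => ?_
    simp only [ite_mul, zero_mul, mul_ite, mul_zero, Finset.sum_ite_eq, Finset.mem_univ, if_true,
      Finset.sum_ite_irrel, Finset.sum_const_zero]
    rw [← ite_mul_annP x y z]
    split_ifs <;> simp
  rw [h4, h5]
  have h6 : ∀ f : Fin n → Fin n → Fin n → Fin n → Module.End ℤ (Finset (P n) → ℤ),
      ∑ x, ∑ y, ∑ z, ∑ t, f x y z t = ∑ x, ∑ y, ∑ z, ∑ t, f y z t x := by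
    intro f
    symm
    rw [Finset.sum_comm]
    refine Finset.sum_congr rfl fun x _ => ?_
    rw [Finset.sum_comm]
    refine Finset.sum_congr rfl fun y _ => ?_
    rw [Finset.sum_comm]
  rw [h6]
  refine Finset.sum_congr rfl fun x _ => Finset.sum_congr rfl fun y _ =>
      Finset.sum_congr rfl fun z _ => Finset.sum_congr rfl fun t _ => ?_
  rw [mul_assoc (annP z t), annP_mul_annP_mul_annP]

/-! ### The transposed boundary -/

/-- The composite edge of two composable edges. -/
def comp (a b : P n) (h : a.1.2 = b.1.1) : P n :=
  ⟨(a.1.1, b.1.2), lt_trans a.2 (by rw [h]; exact b.2)⟩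

/-- The result of replacing two composable edges by their composite. -/
def contract (M : Finset (P n)) (a b : P n) (h : a.1.2 = b.1.1) : Finset (P n) :=
  insert (comp a b h) ((M.erase a).erase b)

lemma comp_ne_left (a b : P n) (h : a.1.2 = b.1.1) : comp a b h ≠ a := by
  intro e
  have h1 : b.1.2 = a.1.2 := congrArg (fun p : P n => p.1.2) (a₁ := comp a b h) e
  exact absurd b.2 (by rw [h1, h]; exact lt_irrefl _)

lemma comp_ne_right (a b : P n) (h : a.1.2 = b.1.1) : comp a b h ≠ b := by
  intro e
  have h1 : a.1.1 = b.1.1 := congrArg (fun p : P n => p.1.1) (a₁ := comp a b h) e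
  exact absurd a.2 (by rw [h1, h]; exact lt_irrefl _)

lemma ne_of_composable {a b : P n} (h : a.1.2 = b.1.1) : a ≠ b := by
  rintro rfl
  exact absurd a.2 (by rw [h]; exact lt_irrefl _)

lemma card_contract {M : Finset (P n)} {a b : P n} (ha : a ∈ M) (hb : b ∈ M)
    (h : a.1.2 = b.1.1) (hc : comp a b h ∉ M) : (contract M a b h).card + 1 = M.card := by
  have hne := ne_of_composable h
  have hb' : b ∈ M.erase a := Finset.mem_erase.2 ⟨hne.symm, hb⟩
  rw [contract, Finset.card_insert_of_notMem (by simp [hc]), Finset.card_erase_add_one hb',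
    Finset.card_erase_add_one ha]

lemma card_contract_lt {M : Finset (P n)} {a b : P n} (ha : a ∈ M) (hb : b ∈ M)
    (h : a.1.2 = b.1.1) (hc : comp a b h ∈ M) : (contract M a b h).card + 2 = M.card := by
  have hne := ne_of_composable h
  have hb' : b ∈ M.erase a := Finset.mem_erase.2 ⟨hne.symm, hb⟩
  rw [contract, Finset.insert_eq_of_mem (by simp [hc, comp_ne_left, comp_ne_right]),
    ← Finset.card_erase_add_one ha, ← Finset.card_erase_add_one hb']

lemma wt_eq_sum (M : Finset (P n)) (i : Fin n) :
    wt M i = i.1 + 1 + ∑ p ∈ M, ((if p.1.1 = i then 1 else 0) - if p.1.2 = i then 1 else 0) := by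
  simp only [wt, Finset.card_filter, Finset.sum_sub_distrib]
  push_cast
  ring

lemma wt_contract {M : Finset (P n)} {a b : P n} (ha : a ∈ M) (hb : b ∈ M)
    (h : a.1.2 = b.1.1) (hc : comp a b h ∉ M) : wt (contract M a b h) = wt M := by
  have hne := ne_of_composable h
  have hb' : b ∈ M.erase a := Finset.mem_erase.2 ⟨hne.symm, hb⟩
  ext i
  rw [wt_eq_sum, wt_eq_sum]
  set g : P n → ℤ := fun p => (if p.1.1 = i then 1 else 0) - if p.1.2 = i then 1 else 0 with hg
  have hgc : g (comp a b h) = g a + g b := by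
    have h1 : (if a.1.2 = i then (1 : ℤ) else 0) = if b.1.1 = i then 1 else 0 := by rw [h]
    simp only [hg, h1, comp]
    ring
  change _ + ∑ p ∈ contract M a b h, g p = _
  rw [contract, Finset.sum_insert (by simp [hc]), hgc, ← Finset.add_sum_erase M g ha,
    ← Finset.add_sum_erase _ g hb']
  ring

/-- The sign of a term of the boundary. -/
def sgn (M : Finset (P n)) (a b : P n) (h : a.1.2 = b.1.1) : ℤ :=
  (-1) ^ (pos M a + pos M b + pos (contract M a b h) (comp a b h))

/-- One term of the transposed boundary. -/
def term (f : Finset (P n) → ℤ) (M : Finset (P n)) (a b : P n) : ℤ :=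
  if h : a.1.2 = b.1.1 then
    if comp a b h ∈ M then 0 else sgn M a b h * f (contract M a b h)
  else 0

/-- The transpose of the boundary, acting on functions on all basis wedges. -/
def tr (f : Finset (P n) → ℤ) (M : Finset (P n)) : ℤ :=
  ∑ a ∈ M, ∑ b ∈ M, term f M a b

lemma term_of_comp {f : Finset (P n) → ℤ} {M : Finset (P n)} {a b : P n} (h : a.1.2 = b.1.1)
    (hc : comp a b h ∉ M) : term f M a b = sgn M a b h * f (contract M a b h) := by
  rw [term, dif_pos h, if_neg hc]

lemma exists_of_term_ne_zero {f : Finset (P n) → ℤ} {M : Finset (P n)} {a b : P n}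
    (ht : term f M a b ≠ 0) :
    ∃ h : a.1.2 = b.1.1, comp a b h ∉ M ∧ f (contract M a b h) ≠ 0 := by
  unfold term at ht
  split_ifs at ht with h1 h2
  · exact absurd rfl ht
  · exact ⟨h1, h2, right_ne_zero_of_mul ht⟩
  · exact absurd rfl ht

lemma ann_ann_cre_apply (f : Finset (P n) → ℤ) (M : Finset (P n)) {a b : P n}
    (h : a.1.2 = b.1.1) :
    (ann b * ann a * cre (comp a b h)) f M = if a ∈ M ∧ b ∈ M then term f M a b else 0 := by
  have hne := ne_of_composable h
  have hk : key a < key b := key_lt_of_fst_lt (by rw [← h]; exact a.2)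
  simp only [Module.End.mul_apply, ann_apply, cre_apply, term, dif_pos h]
  by_cases ha : a ∈ M <;> by_cases hb : b ∈ M <;>
    simp only [ha, hb, Finset.mem_erase, hne, ne_eq, not_false_eq_true, true_and, and_true,
      and_false, if_true, if_false, mul_zero, comp_ne_left, comp_ne_right, sgn]
  split_ifs with hc
  · simp
  · rw [sg_erase hb, tau, if_neg hk.le.not_gt, Finset.erase_right_comm, pow_add, pow_add]
    have h1 : sg ((M.erase a).erase b) (comp a b h) =
        (-1) ^ pos (contract M a b h) (comp a b h) := by
      have := sg_insert (M := (M.erase a).erase b) (a := comp a b h) (by simp [hc]) (comp a b h)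
      rw [tau, if_neg (lt_irrefl _), one_mul] at this
      exact this.symm
    rw [h1]
    simp only [sg, contract]
    ring

lemma sum_P {A : Type*} [AddCommMonoid A] (G : P n → A) :
    ∑ p, G p = ∑ x, ∑ y, if h : x < y then G ⟨(x, y), h⟩ else 0 := by
  rw [← Fintype.sum_prod_type' (f := fun x y => if h : x < y then G ⟨(x, y), h⟩ else 0)]
  refine Fintype.sum_of_injective Subtype.val Subtype.val_injective _ _ ?_ ?_
  · rintro ⟨x, y⟩ h
    rw [dif_neg]
    exact fun h' => h ⟨⟨(x, y), h'⟩, rfl⟩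
  · rintro ⟨⟨x, y⟩, h⟩
    have h' : x < y := h
    simp [h']

lemma tr_eq_opT (f : Finset (P n) → ℤ) : tr f = opT n f := by
  have h1 : opT n = ∑ a : P n, ∑ b : P n,
      if h : a.1.2 = b.1.1 then ann b * ann a * cre (comp a b h) else 0 := by
    rw [sum_P, opT, Fintype.sum_prod_type]
    simp only [Fintype.sum_prod_type]
    refine Finset.sum_congr rfl fun x _ => Finset.sum_congr rfl fun y _ => ?_
    split_ifs with hxy
    · rw [sum_P]
      symm
      rw [Finset.sum_eq_single y]
      · refine Finset.sum_congr rfl fun z _ => ?_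
        by_cases hyz : y < z
        · simp [annP, creP, hxy, hyz, hxy.trans hyz, comp]
        · simp [annP, hyz]
      · intro y' _ hy'
        refine Finset.sum_eq_zero fun z _ => ?_
        split_ifs with h2 h3
        · exact absurd h3.symm hy'
        · rfl
        · rfl
      · simp
    · simp [annP, hxy]
  rw [h1]
  ext M
  simp only [LinearMap.sum_apply, Finset.sum_apply, tr]
  rw [← Finset.sum_subset (Finset.subset_univ M)]
  · refine Finset.sum_congr rfl fun a ha => ?_
    rw [← Finset.sum_subset (Finset.subset_univ M)]
    · refine Finset.sum_congr rfl fun b hb => ?_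
      split_ifs with h
      · rw [ann_ann_cre_apply, if_pos ⟨ha, hb⟩]
      · simp [term, h]
    · intro b _ hb
      split_ifs with h
      · rw [ann_ann_cre_apply, if_neg (by tauto)]
      · rfl
  · intro a _ ha
    refine Finset.sum_eq_zero fun b _ => ?_
    split_ifs with h
    · rw [ann_ann_cre_apply, if_neg (by tauto)]
    · rfl

lemma tr_tr (f : Finset (P n) → ℤ) : tr (tr f) = 0 := by
  rw [tr_eq_opT (tr f), tr_eq_opT f, ← Module.End.mul_apply, opT_mul_opT, LinearMap.zero_apply]

lemma tr_indicator (w : Fin n → ℤ) (f : Finset (P n) → ℤ) (M : Finset (P n)) :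
    tr (fun N => if wt N = w then f N else 0) M = if wt M = w then tr f M else 0 := by
  have h : ∀ a ∈ M, ∀ b ∈ M, term (fun N => if wt N = w then f N else 0) M a b =
      if wt M = w then term f M a b else 0 := by
    intro a ha b hb
    unfold term
    split_ifs with h1 h2 h3 h3 <;> try rfl
    · simp only [wt_contract ha hb h1 h2, if_pos h3]
    · simp only [wt_contract ha hb h1 h2, if_neg h3, mul_zero]
  rw [tr, Finset.sum_congr rfl fun a ha => Finset.sum_congr rfl fun b hb => h a ha b hb]
  split_ifs with h1
  · rfl
  · simp

/-! ### Evaluating functions on chains -/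

/-- Evaluation of a function on basis wedges at a chain of degree `k`. -/
noncomputable def ev (k : ℤ) (f : Finset (P n) → ℤ) : C n k →ₗ[ℤ] ℤ :=
  Finsupp.linearCombination ℤ fun M : B n k => f M.1

/-- Evaluation of a function on basis wedges at a chain of the summand `⟦w⟧`. -/
noncomputable def evW (k : ℤ) (w : Fin n → ℤ) (f : Finset (P n) → ℤ) : Cw n k w →ₗ[ℤ] ℤ :=
  Finsupp.linearCombination ℤ fun M : Bw n k w => f M.1

lemma ev_single (k : ℤ) (f : Finset (P n) → ℤ) (M : B n k) (r : ℤ) :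
    ev k f (Finsupp.single M r) = r * f M.1 := by
  simp [ev]

lemma evW_single (k : ℤ) (w : Fin n → ℤ) (f : Finset (P n) → ℤ) (M : Bw n k w) (r : ℤ) :
    evW k w f (Finsupp.single M r) = r * f M.1 := by
  simp [evW]

lemma evW_eq_sum (k : ℤ) (w : Fin n → ℤ) (f : Finset (P n) → ℤ) (z : Cw n k w) :
    evW k w f z = ∑ M, z M * f M.1 := by
  simp [evW, Finsupp.linearCombination_apply, Finsupp.sum_fintype]

lemma ev_delta (k : ℤ) (M : B n k) (z : C n k) : ev k (Pi.single M.1 1) z = z M := by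
  induction z using Finsupp.induction_linear with
  | zero => simp
  | add x y hx hy => simp [hx, hy]
  | single N r =>
    rw [ev_single]
    by_cases h : N = M
    · simp [h]
    · have : N.1 ≠ M.1 := fun h' => h (Subtype.ext h')
      simp [h, this]

lemma evW_delta (k : ℤ) (w : Fin n → ℤ) (M : Bw n k w) (z : Cw n k w) :
    evW k w (Pi.single M.1 1) z = z M := by
  induction z using Finsupp.induction_linear with
  | zero => simp
  | add x y hx hy => simp [hx, hy]
  | single N r =>
    rw [evW_single]
    by_cases h : N = M
    · simp [h]
    · have : N.1 ≠ M.1 := fun h' => h (Subtype.ext h')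
      simp [h, this]

lemma ext_ev {k : ℤ} {x y : C n k} (h : ∀ f, ev k f x = ev k f y) : x = y := by
  ext M
  rw [← ev_delta, h, ev_delta]

lemma ext_evW {k : ℤ} {w : Fin n → ℤ} {x y : Cw n k w} (h : ∀ f, evW k w f x = evW k w f y) :
    x = y := by
  ext M
  rw [← evW_delta, h, evW_delta]

lemma ev_dAux (k : ℤ) (f : Finset (P n) → ℤ) (M : Finset (P n)) (hM : (M.card : ℤ) = k + 1) :
    ev k f (dAux k M) = tr f M := by
  simp only [dAux, tr, map_sum]
  refine Finset.sum_congr rfl fun a ha => Finset.sum_congr rfl fun b hb => ?_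
  unfold term
  split_ifs with h1 h2 h3 h3
  · have := card_contract_lt ha hb h1 h3
    have h2' : ((contract M a b h1).card : ℤ) = k := h2
    omega
  · rw [map_smul, ev_single, one_mul]; rfl
  · simp
  · have := card_contract ha hb h1 h3
    have h2' : ¬ ((contract M a b h1).card : ℤ) = k := h2
    omega
  · simp

lemma ev_d (k : ℤ) (f : Finset (P n) → ℤ) (z : C n (k + 1)) :
    ev k f (d n k z) = ev (k + 1) (tr f) z := by
  induction z using Finsupp.induction_linear with
  | zero => simp
  | add x y hx hy => simp [hx, hy]
  | single N r =>
    rw [ev_single, d, Finsupp.lsum_single, LinearMap.toSpanSingleton_apply, map_smul,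
      ev_dAux k f N.1 N.2, smul_eq_mul]

lemma ev_inclW (k : ℤ) (w : Fin n → ℤ) (f : Finset (P n) → ℤ) (z : Cw n k w) :
    ev k f (inclW n k w z) = evW k w f z := by
  induction z using Finsupp.induction_linear with
  | zero => simp
  | add x y hx hy => simp [hx, hy]
  | single N r =>
    rw [inclW, Finsupp.lmapDomain_apply, Finsupp.mapDomain_single, ev_single, evW_single]

lemma evW_projW (k : ℤ) (w : Fin n → ℤ) (f : Finset (P n) → ℤ) (z : C n k) :
    evW k w f (projW n k w z) = ev k (fun N => if wt N = w then f N else 0) z := by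
  induction z using Finsupp.induction_linear with
  | zero => simp
  | add x y hx hy => simp [hx, hy]
  | single N r =>
    rw [projW, Finsupp.lsum_single, ev_single]
    split_ifs with h
    · rw [LinearMap.toSpanSingleton_apply, map_smul, evW_single, one_mul, smul_eq_mul]
    · simp

lemma evW_congr {k : ℤ} {w : Fin n → ℤ} {f g : Finset (P n) → ℤ}
    (h : ∀ M, wt M = w → (M.card : ℤ) = k → f M = g M) : evW k w f = evW k w g := by
  ext M
  simp [evW, h M.1 M.2.2 M.2.1]

lemma evW_dW (k : ℤ) (w : Fin n → ℤ) (f : Finset (P n) → ℤ) (z : Cw n (k + 1) w) :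
    evW k w f (dW n k w z) = evW (k + 1) w (tr f) z := by
  rw [dW, LinearMap.comp_apply, LinearMap.comp_apply, evW_projW, ev_d, ev_inclW]
  refine LinearMap.congr_fun (evW_congr fun M hM _ => ?_) z
  rw [tr_indicator, if_pos hM]

lemma projW_inclW (k : ℤ) (w : Fin n → ℤ) (z : Cw n k w) : projW n k w (inclW n k w z) = z := by
  refine ext_evW fun f => ?_
  rw [evW_projW, ev_inclW]
  exact LinearMap.congr_fun (evW_congr fun M hM _ => if_pos hM) z

lemma d_inclW (k : ℤ) (w : Fin n → ℤ) (z : Cw n (k + 1) w) :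
    d n k (inclW n (k + 1) w z) = inclW n k w (dW n k w z) := by
  refine ext_ev fun f => ?_
  rw [ev_d, ev_inclW, ev_inclW, evW_dW]

lemma projW_d (k : ℤ) (w : Fin n → ℤ) (z : C n (k + 1)) :
    projW n k w (d n k z) = dW n k w (projW n (k + 1) w z) := by
  refine ext_evW fun f => ?_
  rw [evW_projW, ev_d, evW_dW, evW_projW]
  congr 2
  ext M
  exact tr_indicator w f M

lemma ev_castC {k l : ℤ} (h : k = l) (f : Finset (P n) → ℤ) (z : C n k) :
    ev l f (castC n h z) = ev k f z := by
  induction z using Finsupp.induction_linear with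
  | zero => simp
  | add x y hx hy => simp [hx, hy]
  | single N r => simp [castC, ev]

lemma evW_castCw (w : Fin n → ℤ) {k l : ℤ} (h : k = l) (f : Finset (P n) → ℤ) (z : Cw n k w) :
    evW l w f (castCw n w h z) = evW k w f z := by
  induction z using Finsupp.induction_linear with
  | zero => simp
  | add x y hx hy => simp [hx, hy]
  | single N r => simp [castCw, evW]

lemma ev_dFrom (k : ℤ) (f : Finset (P n) → ℤ) (z : C n k) :
    ev (k - 1) f (dFrom n k z) = ev k (tr f) z := by
  rw [dFrom, LinearMap.comp_apply, ev_d, LinearEquiv.coe_coe, ev_castC]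

lemma evW_dFromW (k : ℤ) (w : Fin n → ℤ) (f : Finset (P n) → ℤ) (z : Cw n k w) :
    evW (k - 1) w f (dFromW n k w z) = evW k w (tr f) z := by
  rw [dFromW, LinearMap.comp_apply, evW_dW, LinearEquiv.coe_coe, evW_castCw]

lemma mem_ZW_iff {k : ℤ} {w : Fin n → ℤ} {z : Cw n k w} :
    z ∈ ZW n k w ↔ ∀ f, evW k w (tr f) z = 0 := by
  rw [ZW, LinearMap.mem_ker]
  constructor
  · intro h f
    rw [← evW_dFromW, h, map_zero]
  · intro h
    refine ext_evW fun f => ?_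
    rw [evW_dFromW, h, map_zero]

lemma mem_Zfull_iff {k : ℤ} {z : C n k} : z ∈ Zfull n k ↔ ∀ f, ev k (tr f) z = 0 := by
  rw [Zfull, LinearMap.mem_ker]
  constructor
  · intro h f
    rw [← ev_dFrom, h, map_zero]
  · intro h
    refine ext_ev fun f => ?_
    rw [ev_dFrom, h, map_zero]

lemma dW_mem_ZW (k : ℤ) (w : Fin n → ℤ) (z : Cw n (k + 1) w) : dW n k w z ∈ ZW n k w := by
  rw [mem_ZW_iff]
  intro f
  rw [evW_dW, tr_tr, evW_eq_sum]
  simp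

lemma inclW_mem_Zfull {k : ℤ} {w : Fin n → ℤ} {z : Cw n k w} (hz : z ∈ ZW n k w) :
    inclW n k w z ∈ Zfull n k := by
  rw [mem_Zfull_iff]
  intro f
  rw [ev_inclW, mem_ZW_iff.1 hz]

lemma projW_mem_ZW {k : ℤ} (w : Fin n → ℤ) {z : C n k} (hz : z ∈ Zfull n k) :
    projW n k w z ∈ ZW n k w := by
  rw [mem_ZW_iff]
  intro f
  rw [evW_projW]
  simp only [← tr_indicator]
  exact mem_Zfull_iff.1 hz _

lemma mem_HwSub_iff {k : ℤ} {w : Fin n → ℤ} {z : ZW n k w} :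
    z ∈ HwSub n k w ↔ ∃ u, dW n k w u = z := by
  simp [HwSub]

lemma mem_HnilSub_iff {k : ℤ} {z : Zfull n k} : z ∈ HnilSub n k ↔ ∃ u, d n k u = z := by
  simp [HnilSub]

lemma isCompl_range_ker {R X Y : Type*} [Ring R] [AddCommGroup X] [Module R X] [AddCommGroup Y]
    [Module R Y] {f : X →ₗ[R] Y} {g : Y →ₗ[R] X} (h : ∀ x, g (f x) = x) :
    IsCompl (LinearMap.range f) (LinearMap.ker g) := by
  refine IsCompl.of_eq (eq_bot_iff.2 ?_) (eq_top_iff.2 ?_)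
  · rintro _ ⟨⟨x, rfl⟩, hx⟩
    rw [SetLike.mem_coe, LinearMap.mem_ker, h] at hx
    simp [hx]
  · intro y _
    refine Submodule.mem_sup.2 ⟨f (g y), ⟨_, rfl⟩, y - f (g y), ?_, by abel⟩
    rw [LinearMap.mem_ker, map_sub, h, sub_self]

/-- The weight summand is a direct summand in homology. -/
theorem exists_summand_equiv_Hw (n : ℕ) (k : ℤ) (w : Fin n → ℤ) :
    ∃ A B : Submodule ℤ (Hnil n k), IsCompl A B ∧ Nonempty (A ≃ₗ[ℤ] Hw n k w) := by
  let i : ZW n k w →ₗ[ℤ] Zfull n k :=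
    (inclW n k w).restrict (p := ZW n k w) (q := Zfull n k) fun _ hz => inclW_mem_Zfull hz
  let r : Zfull n k →ₗ[ℤ] ZW n k w :=
    (projW n k w).restrict (p := Zfull n k) (q := ZW n k w) fun _ hz => projW_mem_ZW w hz
  let I : Hw n k w →ₗ[ℤ] Hnil n k :=
    Submodule.mapQ _ _ i fun z hz => by
      obtain ⟨u, hu⟩ := mem_HwSub_iff.1 hz
      rw [Submodule.mem_comap, mem_HnilSub_iff]
      exact ⟨inclW n (k + 1) w u, by rw [d_inclW, hu]; rfl⟩
  let R : Hnil n k →ₗ[ℤ] Hw n k w :=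
    Submodule.mapQ _ _ r fun z hz => by
      obtain ⟨u, hu⟩ := mem_HnilSub_iff.1 hz
      rw [Submodule.mem_comap, mem_HwSub_iff]
      exact ⟨projW n (k + 1) w u, by rw [← projW_d, hu]; rfl⟩
  have hRI : ∀ x, R (I x) = x := by
    intro x
    obtain ⟨z, rfl⟩ := Submodule.Quotient.mk_surjective _ x
    exact congrArg (Submodule.Quotient.mk (p := HwSub n k w)) <| Subtype.ext (projW_inclW k w z.1)
  exact ⟨LinearMap.range I, LinearMap.ker R, isCompl_range_ker hRI,
    ⟨(LinearEquiv.ofInjective I (Function.LeftInverse.injective hRI)).symm⟩⟩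

/-! ### Wedges of weight `(2, 3, …, q + 1, 2, q + 1, q + 3, …, n)` -/

/-- The weight `(2, 3, …, q + 1, 2, q + 1)` prolonged by `q + 3, …, n`. -/
def wqn (q n : ℕ) : Fin n → ℤ := fun i =>
  if i.1 < q then (i.1 : ℤ) + 2 else if i.1 = q then 2 else if i.1 = q + 1 then (q : ℤ) + 1
  else (i.1 : ℤ) + 1

lemma wqn_add_two (q : ℕ) : wqn q (q + 2) = wq q := by
  ext i
  have := i.isLt
  unfold wqn wq
  split_ifs with h1 h2 h3 <;> try rfl
  omega

/-- The elements of `M` ending in `j`. -/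
def inE (M : Finset (P n)) (j : ℕ) : Finset (P n) := M.filter fun p => p.1.2.1 = j

/-- The elements of `M` starting in `j`. -/
def outE (M : Finset (P n)) (j : ℕ) : Finset (P n) := M.filter fun p => p.1.1.1 = j

/-- The elements of `M` ending before `q`. -/
def inner (q : ℕ) (M : Finset (P n)) : Finset (P n) := M.filter fun p => p.1.2.1 < q

/-- The pairs ending in `q`. -/
def spokes (q n : ℕ) : Finset (P n) := Finset.univ.filter fun p => p.1.2.1 = q

lemma mem_inE {M : Finset (P n)} {j : ℕ} {p : P n} : p ∈ inE M j ↔ p ∈ M ∧ p.1.2.1 = j := by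
  simp [inE]

lemma mem_outE {M : Finset (P n)} {j : ℕ} {p : P n} : p ∈ outE M j ↔ p ∈ M ∧ p.1.1.1 = j := by
  simp [outE]

lemma mem_inner {q : ℕ} {M : Finset (P n)} {p : P n} :
    p ∈ inner q M ↔ p ∈ M ∧ p.1.2.1 < q := by
  simp [inner]

lemma mem_spokes {q : ℕ} {p : P n} : p ∈ spokes q n ↔ p.1.2.1 = q := by
  simp [spokes]

lemma P_ext {a b : P n} (h1 : a.1.1.1 = b.1.1.1) (h2 : a.1.2.1 = b.1.2.1) : a = b :=
  Subtype.ext (Prod.ext (Fin.ext h1) (Fin.ext h2))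

lemma P_lt (p : P n) : p.1.1.1 < p.1.2.1 := p.2

/-- The pair `(i, j)` of natural numbers as an element of `P n`. -/
def mkP (i j : ℕ) (hij : i < j) (hj : j < n) : P n := ⟨(⟨i, hij.trans hj⟩, ⟨j, hj⟩), hij⟩

lemma eq_mkP {i j : ℕ} {hij : i < j} {hj : j < n} {p : P n} (h1 : p.1.1.1 = i)
    (h2 : p.1.2.1 = j) : p = mkP i j hij hj :=
  P_ext h1 h2

variable {q : ℕ}

lemma card_spokes (hn : q + 2 ≤ n) : (spokes q n).card = q := by
  have : (spokes q n).card = (Finset.univ : Finset (Fin q)).card := by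
    symm
    refine Finset.card_bij (fun i _ => mkP i.1 q i.2 (by omega)) ?_ ?_ ?_
    · intro i _; exact mem_spokes.2 rfl
    · intro i _ j _ h
      exact Fin.ext (congrArg (fun p : P n => p.1.1.1) h)
    · intro p hp
      rw [mem_spokes] at hp
      have := P_lt p
      exact ⟨⟨p.1.1.1, by omega⟩, Finset.mem_univ _, P_ext rfl hp.symm⟩
  rw [this, Finset.card_univ, Fintype.card_fin]

lemma wt_eq (M : Finset (P n)) (i : Fin n) :
    wt M i = i.1 + 1 - (inE M i).card + (outE M i).card := by
  simp only [wt, inE, outE, Fin.ext_iff]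

/-- The pair joining `q` to `q + 1`. -/
def axle (hn : q + 2 ≤ n) : P n := mkP q (q + 1) (by omega) (by omega)

section

variable {M N N' : Finset (P n)}

lemma flow (hn : q + 2 ≤ n) (hM : wt M = wqn q n) (j : ℕ) :
    ((outE M j).card : ℤ) - (inE M j).card =
      if j < q then (1 : ℤ) else if j = q then 1 - (q : ℤ) else if j = q + 1 then -1 else 0 := by
  by_cases hj : j < n
  · have := congrFun hM ⟨j, hj⟩
    rw [wt_eq] at this
    simp only [wqn] at this
    split_ifs at this ⊢ <;> omega
  · have h1 : outE M j = ∅ := by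
      ext p
      have := p.1.1.isLt
      simp only [mem_outE, Finset.notMem_empty, iff_false]
      omega
    have h2 : inE M j = ∅ := by
      ext p
      have := p.1.2.isLt
      simp only [mem_inE, Finset.notMem_empty, iff_false]
      omega
    rw [h1, h2, if_neg (by omega), if_neg (by omega), if_neg (by omega)]
    simp

lemma snd_le (hn : q + 2 ≤ n) (hM : wt M = wqn q n) {p : P n} (hp : p ∈ M) :
    p.1.2.1 ≤ q + 1 := by
  by_contra! h
  obtain ⟨r, hr, hmax⟩ := Finset.exists_max_image (M.filter fun p => q + 1 < p.1.2.1)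
    (fun p => p.1.2.1) ⟨p, by simp [hp, h]⟩
  simp only [Finset.mem_filter] at hr hmax
  have hf := flow hn hM r.1.2.1
  rw [if_neg (by omega), if_neg (by omega), if_neg (by omega)] at hf
  have h1 : 0 < (inE M r.1.2.1).card := Finset.card_pos.2 ⟨r, mem_inE.2 ⟨hr.1, rfl⟩⟩
  have h2 : 0 < (outE M r.1.2.1).card := by omega
  obtain ⟨t, ht⟩ := Finset.card_pos.1 h2
  rw [mem_outE] at ht
  have h3 := P_lt t
  have := hmax t ⟨ht.1, by omega⟩
  omega

lemma card_outE_of_lt (hn : q + 2 ≤ n) (hM : wt M = wqn q n) {j : ℕ} (hj : j < q) :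
    (outE M j).card = (inE M j).card + 1 := by
  have hf := flow hn hM j
  rw [if_pos hj] at hf
  omega

lemma outE_sink (hn : q + 2 ≤ n) (hM : wt M = wqn q n) : outE M (q + 1) = ∅ := by
  ext p
  simp only [mem_outE, Finset.notMem_empty, iff_false, not_and]
  intro hp h
  have := snd_le hn hM hp
  have := P_lt p
  omega

lemma card_inE_sink (hn : q + 2 ≤ n) (hM : wt M = wqn q n) : (inE M (q + 1)).card = 1 := by
  have hf := flow hn hM (q + 1)
  rw [if_neg (by omega), if_neg (by omega), if_pos rfl, outE_sink hn hM] at hf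
  simp at hf
  omega

lemma eq_of_mem_sink (hn : q + 2 ≤ n) (hM : wt M = wqn q n) {a b : P n} (ha : a ∈ M) (hb : b ∈ M)
    (ha' : a.1.2.1 = q + 1) (hb' : b.1.2.1 = q + 1) : a = b :=
  Finset.card_le_one.1 (card_inE_sink hn hM).le a (mem_inE.2 ⟨ha, ha'⟩) b (mem_inE.2 ⟨hb, hb'⟩)

lemma card_inE_hub (hn : q + 2 ≤ n) (hM : wt M = wqn q n) :
    (inE M q).card + 1 = q + (outE M q).card := by
  have hf := flow hn hM q
  rw [if_neg (by omega), if_pos rfl] at hf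
  omega

lemma mem_outE_hub (hn : q + 2 ≤ n) (hM : wt M = wqn q n) {p : P n} (hp : p ∈ M)
    (h : p.1.1.1 = q) : p = axle hn := by
  have := snd_le hn hM hp
  have := P_lt p
  exact eq_mkP h (by omega)

lemma outE_hub_of_mem (hn : q + 2 ≤ n) (hM : wt M = wqn q n) (h : axle hn ∈ M) :
    (outE M q).card = 1 := by
  rw [Finset.card_eq_one]
  refine ⟨axle hn, ?_⟩
  ext p
  rw [mem_outE, Finset.mem_singleton]
  exact ⟨fun hp => mem_outE_hub hn hM hp.1 hp.2, fun hp => ⟨hp ▸ h, by rw [hp]; rfl⟩⟩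

lemma outE_hub_of_notMem (hn : q + 2 ≤ n) (hM : wt M = wqn q n) (h : axle hn ∉ M) :
    (outE M q).card = 0 := by
  rw [Finset.card_eq_zero]
  ext p
  simp only [mem_outE, Finset.notMem_empty, iff_false, not_and]
  intro hp hpq
  exact h (mem_outE_hub hn hM hp hpq ▸ hp)

lemma card_missing (hn : q + 2 ≤ n) (hM : wt M = wqn q n) :
    (spokes q n \ M).card + (outE M q).card = 1 := by
  have h1 : spokes q n ∩ M = inE M q := by
    ext p; rw [Finset.mem_inter, mem_spokes, mem_inE, and_comm]
  have h2 := Finset.card_sdiff_add_card_inter (spokes q n) M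
  rw [h1, card_spokes hn] at h2
  have := card_inE_hub hn hM
  omega

lemma missing_unique (hn : q + 2 ≤ n) (hM : wt M = wqn q n) {a b : P n} (ha : a ∉ M) (hb : b ∉ M)
    (ha' : a.1.2.1 = q) (hb' : b.1.2.1 = q) : a = b := by
  have h1 := card_missing hn hM
  have h2 : (spokes q n \ M).card ≤ 1 := by omega
  refine Finset.card_le_one.1 h2 a ?_ b ?_
  · rw [Finset.mem_sdiff, mem_spokes]; exact ⟨ha', ha⟩
  · rw [Finset.mem_sdiff, mem_spokes]; exact ⟨hb', hb⟩

lemma axle_notMem_of_missing (hn : q + 2 ≤ n) (hM : wt M = wqn q n) {a : P n} (ha : a ∉ M)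
    (ha' : a.1.2.1 = q) : axle hn ∉ M := by
  intro h
  have h1 := card_missing hn hM
  rw [outE_hub_of_mem hn hM h] at h1
  have h2 : 0 < (spokes q n \ M).card :=
    Finset.card_pos.2 ⟨a, by rw [Finset.mem_sdiff, mem_spokes]; exact ⟨ha', ha⟩⟩
  omega

lemma exists_missing (hn : q + 2 ≤ n) (hM : wt M = wqn q n) (h : axle hn ∉ M) :
    ∃ a : P n, a ∉ M ∧ a.1.2.1 = q := by
  have h1 := card_missing hn hM
  rw [outE_hub_of_notMem hn hM h] at h1
  obtain ⟨a, ha⟩ := Finset.card_pos.1 (by omega : 0 < (spokes q n \ M).card)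
  rw [Finset.mem_sdiff, mem_spokes] at ha
  exact ⟨a, ha.2, ha.1⟩

lemma card_eq (hn : q + 2 ≤ n) (hM : wt M = wqn q n) :
    M.card = (inner q M).card + q + (outE M q).card := by
  have h1 := Finset.card_filter_add_card_filter_not (s := M) (fun p : P n => p.1.2.1 < q)
  have h2 : M.filter (fun p : P n => ¬ p.1.2.1 < q) = inE M q ∪ inE M (q + 1) := by
    ext p
    simp only [Finset.mem_filter, Finset.mem_union, mem_inE]
    constructor
    · rintro ⟨hp, h⟩
      have := snd_le hn hM hp
      have : p.1.2.1 = q ∨ p.1.2.1 = q + 1 := by omega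
      tauto
    · rintro (⟨hp, h⟩ | ⟨hp, h⟩) <;> exact ⟨hp, by omega⟩
  rw [h2, Finset.card_union_of_disjoint, card_inE_sink hn hM] at h1
  · have := card_inE_hub hn hM
    change (inner q M).card + _ = _ at h1
    omega
  · rw [Finset.disjoint_left]
    intro p hp hp'
    rw [mem_inE] at hp hp'
    omega

lemma inner_eq_empty (hn : q + 2 ≤ n) (hM : wt M = wqn q n)
    (h : ∀ p ∈ inner q M, ∃ r ∈ M, r ≠ p ∧ r.1.1.1 = p.1.1.1) : inner q M = ∅ := by
  by_contra! hne
  obtain ⟨p, hp, hmin⟩ := Finset.exists_min_image (inner q M) (fun p => p.1.1.1) hne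
  obtain ⟨r, hr, hrp, hr1⟩ := h p hp
  rw [mem_inner] at hp
  have hlt := P_lt p
  have h1 : 1 < (outE M p.1.1.1).card :=
    Finset.one_lt_card.2 ⟨r, mem_outE.2 ⟨hr, hr1⟩, p, mem_outE.2 ⟨hp.1, rfl⟩, hrp⟩
  have h2 := card_outE_of_lt hn hM (j := p.1.1.1) (by omega)
  obtain ⟨t, ht⟩ := Finset.card_pos.1 (by omega : 0 < (inE M p.1.1.1).card)
  rw [mem_inE] at ht
  have h3 := hmin t (mem_inner.2 ⟨ht.1, by omega⟩)
  have h4 := P_lt t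
  omega

/-- The pair joining `0` to `q`. -/
def spoke₀ (hn : q + 2 ≤ n) (hq : 0 < q) : P n := mkP 0 q hq (by omega)

lemma card_outE_zero (hn : q + 2 ≤ n) (hq : 0 < q) (hM : wt M = wqn q n) :
    (outE M 0).card = 1 := by
  rw [card_outE_of_lt hn hM hq]
  have : inE M 0 = ∅ := by
    ext p
    have := P_lt p
    simp only [mem_inE, Finset.notMem_empty, iff_false]
    omega
  rw [this]; rfl

lemma outE_zero_unique (hn : q + 2 ≤ n) (hq : 0 < q) (hM : wt M = wqn q n) {a b : P n}
    (ha : a ∈ M) (hb : b ∈ M) (ha' : a.1.1.1 = 0) (hb' : b.1.1.1 = 0) : a = b := by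
  have h1 := mem_outE.2 ⟨ha, ha'⟩
  have h2 := mem_outE.2 ⟨hb, hb'⟩
  exact Finset.card_le_one.1 (card_outE_zero hn hq hM).le a h1 b h2

/-- `M` arises from `N` by replacing two composable elements by `spoke₀`. -/
def Matched (hn : q + 2 ≤ n) (hq : 0 < q) (N M : Finset (P n)) : Prop :=
  ∃ a ∈ N, ∃ b ∈ N, ∃ h : a.1.2 = b.1.1, comp a b h = spoke₀ hn hq ∧ comp a b h ∉ N ∧
    M = contract N a b h

lemma eq_insert_contract {a b : P n} (ha : a ∈ N) (hb : b ∈ N) (h : a.1.2 = b.1.1)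
    (hc : comp a b h ∉ N) :
    N = insert a (insert b ((contract N a b h).erase (comp a b h))) := by
  have hne := ne_of_composable h
  rw [contract, Finset.erase_insert (by simp [hc]),
    Finset.insert_erase (Finset.mem_erase.2 ⟨hne.symm, hb⟩), Finset.insert_erase ha]

lemma right_notMem_contract {a b : P n} (h : a.1.2 = b.1.1) : b ∉ contract N a b h := by
  simp [contract, (comp_ne_right a b h).symm]

lemma Matched.notMem {hn : q + 2 ≤ n} {hq : 0 < q} (h : Matched hn hq N M) :
    spoke₀ hn hq ∉ N := by
  obtain ⟨a, _, b, _, h, h1, h2, _⟩ := h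
  rwa [← h1]

lemma Matched.mem {hn : q + 2 ≤ n} {hq : 0 < q} (h : Matched hn hq N M) : spoke₀ hn hq ∈ M := by
  obtain ⟨a, _, b, _, h, h1, h2, rfl⟩ := h
  rw [← h1]
  exact Finset.mem_insert_self _ _

lemma Matched.wt_eq {hn : q + 2 ≤ n} {hq : 0 < q} (h : Matched hn hq N M) : wt M = wt N := by
  obtain ⟨a, ha, b, hb, h, h1, h2, rfl⟩ := h
  exact wt_contract ha hb h h2

lemma Matched.card_eq {hn : q + 2 ≤ n} {hq : 0 < q} (h : Matched hn hq N M) :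
    M.card + 1 = N.card := by
  obtain ⟨a, ha, b, hb, h, h1, h2, rfl⟩ := h
  exact card_contract ha hb h h2

lemma exists_matched_left (hn : q + 2 ≤ n) (hq : 0 < q) (hM : wt M = wqn q n)
    (h0 : spoke₀ hn hq ∈ M) (h : axle hn ∉ M) : ∃ N, Matched hn hq N M := by
  obtain ⟨m, hm, hmq⟩ := exists_missing hn hM h
  have hlt := P_lt m
  have hm0 : 0 < m.1.1.1 := by
    rw [Nat.pos_iff_ne_zero]
    intro h'
    exact hm (by rwa [show m = spoke₀ hn hq from eq_mkP h' hmq])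
  let a : P n := mkP 0 m.1.1.1 hm0 (by omega)
  have ha : a ∉ M := by
    intro ha
    have := outE_zero_unique hn hq hM ha h0 rfl rfl
    have : m.1.1.1 = q := congrArg (fun p : P n => p.1.2.1) this
    omega
  have hcomp : a.1.2 = m.1.1 := rfl
  have hc : comp a m hcomp = spoke₀ hn hq := P_ext rfl hmq
  have ham := ne_of_composable hcomp
  have hca := comp_ne_left a m hcomp
  have hcm := comp_ne_right a m hcomp
  rw [hc] at hca hcm
  refine ⟨insert a (insert m (M.erase (spoke₀ hn hq))), a, by simp, m, by simp, hcomp, hc, ?_, ?_⟩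
  · rw [hc]; simp [hca, hcm]
  · rw [contract, hc, Finset.erase_insert (by simp [ha, ham]), Finset.erase_insert (by simp [hm]),
      Finset.insert_erase h0]

lemma exists_matched_right (hn : q + 2 ≤ n) (hq : 0 < q) (hN : wt N = wqn q n)
    (h0 : spoke₀ hn hq ∉ N) (hcard : N.card ≠ q) : ∃ M, Matched hn hq N M := by
  have hax := axle_notMem_of_missing hn hN h0 rfl
  obtain ⟨a, ha⟩ := Finset.card_pos.1 (by rw [card_outE_zero hn hq hN]; exact one_pos)
  rw [mem_outE] at ha
  have hlt := P_lt a
  have ha1 : a.1.2.1 ≠ q := by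
    intro h
    exact h0 (by rw [show spoke₀ hn hq = a from (eq_mkP ha.2 h).symm]; exact ha.1)
  have ha2 := snd_le hn hN ha.1
  have hmem : ∀ y, 0 < y → (hy : y < q) → mkP y q hy (by omega) ∈ N := by
    intro y hy0 hy
    by_contra hb
    have h1 := missing_unique hn hN hb h0 rfl rfl
    have : y = 0 := congrArg (fun p : P n => p.1.1.1) h1
    omega
  by_cases haq : a.1.2.1 = q + 1
  · exfalso
    have hinner : inner q N = ∅ := by
      refine inner_eq_empty hn hN fun p hp => ?_
      rw [mem_inner] at hp
      have hpl := P_lt p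
      have hp0 : 0 < p.1.1.1 := by
        rw [Nat.pos_iff_ne_zero]
        intro h
        have := outE_zero_unique hn hq hN hp.1 ha.1 h ha.2
        rw [this] at hp
        omega
      refine ⟨_, hmem p.1.1.1 hp0 (by omega), ?_, rfl⟩
      intro h
      have : q = p.1.2.1 := congrArg (fun p : P n => p.1.2.1) h
      omega
    have h1 := card_eq hn hN
    rw [hinner, outE_hub_of_notMem hn hN hax] at h1
    simp at h1
    exact hcard h1
  · have hlt' : a.1.2.1 < q := by omega
    refine ⟨_, a, ha.1, _, hmem a.1.2.1 (by omega) hlt', rfl, ?_, ?_, rfl⟩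
    · exact P_ext ha.2 rfl
    · rw [show comp a (mkP a.1.2.1 q hlt' (by omega)) rfl = spoke₀ hn hq from P_ext ha.2 rfl]
      exact h0

lemma Matched.left_unique {hn : q + 2 ≤ n} {hq : 0 < q} (hM : wt M = wqn q n)
    (h : Matched hn hq N M) (h' : Matched hn hq N' M) : N = N' := by
  obtain ⟨a, ha, b, hb, h, h1, h2, h3⟩ := h
  obtain ⟨a', ha', b', hb', h', h1', h2', h3'⟩ := h'
  have e1 : b = b' := by
    refine missing_unique hn hM ?_ ?_ (congrArg (fun p : P n => p.1.2.1) h1)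
      (congrArg (fun p : P n => p.1.2.1) h1')
    · rw [h3]; exact right_notMem_contract h
    · rw [h3']; exact right_notMem_contract h'
  subst e1
  have e2 : a = a' := by
    refine P_ext ?_ (by rw [h, h'])
    have h4 : comp a b h = comp a' b h' := h1.trans h1'.symm
    exact congrArg (fun p : P n => p.1.1.1) (a₁ := comp a b h) (a₂ := comp a' b h') h4
  subst e2
  rw [eq_insert_contract ha hb h h2, eq_insert_contract ha' hb' h' h2', ← h3, ← h3']

lemma Matched.unique_pair {hn : q + 2 ≤ n} {hq : 0 < q} (hN : wt N = wqn q n) {a b a' b' : P n}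
    (ha : a ∈ N) (ha' : a' ∈ N) (h : a.1.2 = b.1.1) (h' : a'.1.2 = b'.1.1)
    (h1 : comp a b h = spoke₀ hn hq) (h1' : comp a' b' h' = spoke₀ hn hq) : a = a' ∧ b = b' := by
  have e1 : a = a' := outE_zero_unique hn hq hN ha ha' (congrArg (fun p : P n => p.1.1.1) h1)
    (congrArg (fun p : P n => p.1.1.1) h1')
  subst e1
  refine ⟨rfl, P_ext (by rw [← h, ← h']) ?_⟩
  have h3 : comp a b h = comp a b' h' := h1.trans h1'.symm
  exact congrArg (fun p : P n => p.1.2.1) (a₁ := comp a b h) (a₂ := comp a b' h') h3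

lemma Matched.right_unique {hn : q + 2 ≤ n} {hq : 0 < q} (hN : wt N = wqn q n)
    {M' : Finset (P n)} (h : Matched hn hq N M) (h' : Matched hn hq N M') : M = M' := by
  obtain ⟨a, ha, b, hb, h, h1, h2, h3⟩ := h
  obtain ⟨a', ha', b', hb', h', h1', h2', h3'⟩ := h'
  obtain ⟨rfl, rfl⟩ := Matched.unique_pair hN ha ha' h h' h1 h1'
  rw [h3, h3']

lemma comp_eq_of_contract_eq {a b : P n} {h : a.1.2 = b.1.1} {c : P n} (hN : c ∉ N) (hM : c ∈ M)
    (e : contract N a b h = M) : comp a b h = c := by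
  rw [← e, contract, Finset.mem_insert] at hM
  rcases hM with hM | hM
  · exact hM.symm
  · exact absurd (Finset.mem_of_mem_erase (Finset.mem_of_mem_erase hM)) hN

lemma matched_of_tr_ne_zero {hn : q + 2 ≤ n} {hq : 0 < q} (hN : spoke₀ hn hq ∉ N)
    (hM : spoke₀ hn hq ∈ M) (h : tr (Pi.single M 1) N ≠ 0) : Matched hn hq N M := by
  obtain ⟨a, ha, h⟩ := Finset.exists_ne_zero_of_sum_ne_zero h
  obtain ⟨b, hb, h⟩ := Finset.exists_ne_zero_of_sum_ne_zero h
  obtain ⟨h, hc, h1⟩ := exists_of_term_ne_zero h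
  have h2 : contract N a b h = M := by
    by_contra h'
    rw [Pi.single_eq_of_ne h'] at h1
    exact h1 rfl
  exact ⟨a, ha, b, hb, h, comp_eq_of_contract_eq hN hM h2, hc, h2.symm⟩

lemma sgn_mul_self (N : Finset (P n)) (a b : P n) (h : a.1.2 = b.1.1) :
    sgn N a b h * sgn N a b h = 1 := by
  unfold sgn; rw [← pow_add, ← two_mul, pow_mul]; simp

lemma Matched.tr_mul_self {hn : q + 2 ≤ n} {hq : 0 < q} (hN : wt N = wqn q n)
    (h : Matched hn hq N M) : tr (Pi.single M 1) N * tr (Pi.single M 1) N = 1 := by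
  have h0 := h.notMem
  have h0' := h.mem
  obtain ⟨a, ha, b, hb, h, h1, h2, h3⟩ := h
  have huniq : ∀ a' ∈ N, ∀ b', term (Pi.single M 1) N a' b' ≠ 0 → a' = a ∧ b' = b := by
    intro a' ha' b' ht
    obtain ⟨h', hc', ht⟩ := exists_of_term_ne_zero ht
    have h4 : contract N a' b' h' = M := by
      by_contra h'
      rw [Pi.single_eq_of_ne h'] at ht
      exact ht rfl
    have h5 := comp_eq_of_contract_eq h0 h0' h4
    exact Matched.unique_pair hN ha' ha h' h h5 h1
  have : tr (Pi.single M 1) N = sgn N a b h := by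
    rw [tr, Finset.sum_eq_single a, Finset.sum_eq_single b, term_of_comp h h2, ← h3,
      Pi.single_eq_same, mul_one]
    · intro b' _ hb'
      by_contra ht
      exact hb' (huniq a ha b' ht).2
    · exact fun h => absurd hb h
    · intro a' ha' hne
      refine Finset.sum_eq_zero fun b' _ => ?_
      by_contra ht
      exact hne (huniq a' ha' b' ht).1
    · exact fun h => absurd ha h
  rw [this, sgn_mul_self]

end

/-! ### The wedge containing the axle, and the exceptional wedge of degree `q` -/

section

variable {M N N' : Finset (P n)}

lemma inner_eq_empty_of_axle (hn : q + 2 ≤ n) (hM : wt M = wqn q n) (h : axle hn ∈ M) :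
    inner q M = ∅ := by
  refine inner_eq_empty hn hM fun p hp => ?_
  rw [mem_inner] at hp
  have hlt := P_lt p
  refine ⟨mkP p.1.1.1 q (by omega) (by omega), ?_, ?_, rfl⟩
  · by_contra h'
    exact axle_notMem_of_missing hn hM h' rfl h
  · intro h'
    have : q = p.1.2.1 := congrArg (fun p : P n => p.1.2.1) h'
    omega

lemma card_of_axle (hn : q + 2 ≤ n) (hM : wt M = wqn q n) (h : axle hn ∈ M) :
    M.card = q + 1 := by
  rw [card_eq hn hM, inner_eq_empty_of_axle hn hM h, outE_hub_of_mem hn hM h]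
  simp

/-- All pairs ending in `q`, and the pair joining `q` to `q + 1`. -/
def wheel (hn : q + 2 ≤ n) : Finset (P n) := insert (axle hn) (spokes q n)

lemma mem_wheel {hn : q + 2 ≤ n} {p : P n} : p ∈ wheel hn ↔ p = axle hn ∨ p.1.2.1 = q := by
  rw [wheel, Finset.mem_insert, mem_spokes]

lemma axle_mem_wheel (hn : q + 2 ≤ n) : axle hn ∈ wheel hn := mem_wheel.2 (Or.inl rfl)

lemma eq_wheel (hn : q + 2 ≤ n) (hM : wt M = wqn q n) (h : axle hn ∈ M) : M = wheel hn := by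
  ext p
  rw [mem_wheel]
  constructor
  · intro hp
    have h1 := snd_le hn hM hp
    by_cases h2 : p.1.2.1 < q
    · have h3 := mem_inner.2 ⟨hp, h2⟩
      simp [inner_eq_empty_of_axle hn hM h] at h3
    · by_cases h3 : p.1.2.1 = q
      · exact Or.inr h3
      · exact Or.inl (eq_of_mem_sink hn hM hp h (by omega) rfl)
  · rintro (rfl | hp)
    · exact h
    · by_contra h'
      exact axle_notMem_of_missing hn hM h' hp h

lemma wt_wheel (hn : q + 2 ≤ n) : wt (wheel hn) = wqn q n := by
  ext i
  rw [wt_eq, wqn]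
  have e0 : ∀ j, j ≠ q → j ≠ q + 1 → inE (wheel hn) j = ∅ := by
    intro j h1 h2
    ext p
    simp only [mem_inE, mem_wheel, Finset.notMem_empty, iff_false]
    rintro ⟨rfl | h, h'⟩
    · exact h2 h'.symm
    · omega
  have e1 : ∀ j, q < j → outE (wheel hn) j = ∅ := by
    intro j h1
    ext p
    simp only [mem_outE, mem_wheel, Finset.notMem_empty, iff_false]
    rintro ⟨rfl | h, h'⟩
    · have : q = j := h'
      omega
    · have := P_lt p
      omega
  split_ifs with h1 h2 h3
  · have e2 : outE (wheel hn) i.1 = {mkP i.1 q h1 (by omega)} := by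
      ext p
      rw [mem_outE, mem_wheel, Finset.mem_singleton]
      constructor
      · rintro ⟨rfl | h, h'⟩
        · have : q = i.1 := h'
          omega
        · exact eq_mkP h' h
      · rintro rfl
        exact ⟨Or.inr rfl, rfl⟩
    rw [e0 _ (by omega) (by omega), e2]
    simp
    ring
  · have e2 : outE (wheel hn) i.1 = {axle hn} := by
      ext p
      rw [mem_outE, mem_wheel, Finset.mem_singleton]
      constructor
      · rintro ⟨rfl | h, h'⟩
        · rfl
        · have := P_lt p
          omega
      · rintro rfl
        exact ⟨Or.inl rfl, h2.symm⟩
    have e3 : inE (wheel hn) i.1 = spokes q n := by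
      ext p
      rw [mem_inE, mem_wheel, mem_spokes, h2]
      constructor
      · exact fun h => h.2
      · exact fun h => ⟨Or.inr h, h⟩
    rw [e2, e3, card_spokes hn, h2, Finset.card_singleton]
    push_cast
    ring
  · have e3 : inE (wheel hn) i.1 = {axle hn} := by
      ext p
      rw [mem_inE, mem_wheel, Finset.mem_singleton]
      constructor
      · rintro ⟨h | h, h'⟩
        · exact h
        · omega
      · rintro rfl
        exact ⟨Or.inl rfl, h3.symm⟩
    rw [e1 _ (by omega), e3, h3]
    simp
  · rw [e1 _ (by omega), e0 _ h2 h3]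
    simp

lemma card_wheel (hn : q + 2 ≤ n) : (wheel hn).card = q + 1 :=
  card_of_axle hn (wt_wheel hn) (axle_mem_wheel hn)

lemma le_card (hn : q + 2 ≤ n) (hM : wt M = wqn q n) : q ≤ M.card := by
  rw [card_eq hn hM]; omega

lemma mem_iff_of_card (hn : q + 2 ≤ n) (hq : 0 < q) (hN : wt N = wqn q n)
    (h0 : spoke₀ hn hq ∉ N) (hc : N.card = q) {p : P n} :
    p ∈ N ↔ (p.1.2.1 = q ∧ p ≠ spoke₀ hn hq) ∨ (p.1.1.1 = 0 ∧ p.1.2.1 = q + 1) := by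
  have hinner : inner q N = ∅ := by
    have := card_eq hn hN
    exact Finset.card_eq_zero.1 (by omega)
  have hlt : ∀ p ∈ N, p.1.2.1 = q ∨ p.1.2.1 = q + 1 := by
    intro p hp
    have h1 := snd_le hn hN hp
    by_cases h2 : p.1.2.1 < q
    · have h3 := mem_inner.2 ⟨hp, h2⟩
      simp [hinner] at h3
    · omega
  obtain ⟨t, ht⟩ := Finset.card_pos.1 (by rw [card_outE_zero hn hq hN]; exact one_pos)
  rw [mem_outE] at ht
  have ht2 : t.1.2.1 = q + 1 := by
    refine (hlt t ht.1).resolve_left fun h => h0 ?_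
    rw [show spoke₀ hn hq = t from (eq_mkP ht.2 h).symm]
    exact ht.1
  constructor
  · intro hp
    rcases hlt p hp with h | h
    · exact Or.inl ⟨h, fun h' => h0 (h' ▸ hp)⟩
    · right
      rw [eq_of_mem_sink hn hN hp ht.1 h ht2]
      exact ⟨ht.2, ht2⟩
  · rintro (⟨h1, h2⟩ | ⟨h1, h2⟩)
    · by_contra h
      exact h2 (missing_unique hn hN h h0 h1 rfl)
    · rw [P_ext (h1.trans ht.2.symm) (h2.trans ht2.symm)]
      exact ht.1

lemma exists_exceptional (hn : q + 2 ≤ n) (hq : 0 < q) :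
    ∃ M : Finset (P n), wt M = wqn q n ∧ M.card = q ∧ spoke₀ hn hq ∉ M := by
  have h1 : spoke₀ hn hq ∈ wheel hn := mem_wheel.2 (Or.inr rfl)
  have h : (spoke₀ hn hq).1.2 = (axle hn).1.1 := rfl
  have hc : comp _ _ h ∉ wheel hn := by
    rw [mem_wheel]
    rintro (h' | h')
    · exact comp_ne_right _ _ h h'
    · have : q + 1 = q := h'
      omega
  refine ⟨contract (wheel hn) _ _ h, ?_, ?_, ?_⟩
  · rw [wt_contract h1 (axle_mem_wheel hn) h hc, wt_wheel]
  · have := card_contract h1 (axle_mem_wheel hn) h hc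
    rw [card_wheel] at this
    omega
  · simp [contract, (comp_ne_left _ _ h).symm]

/-! ### The transposed boundary of the constant function -/

lemma comp_notMem_of_unique {a b : P n} (h : a.1.2 = b.1.1)
    (hu : ∀ e ∈ N, e.1.1.1 = a.1.1.1 → e = a) : comp a b h ∉ N :=
  fun hc => comp_ne_left a b h (hu _ hc rfl)

lemma pos_comp {a b : P n} (h : a.1.2 = b.1.1) (hu : ∀ e ∈ N, e.1.1.1 = a.1.1.1 → e = a) :
    pos (contract N a b h) (comp a b h) = pos N a := by
  unfold pos
  congr 1
  ext e
  have h1 := P_lt a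
  have h2 : a.1.2.1 = b.1.1.1 := congrArg Fin.val h
  simp only [Finset.mem_filter, contract, Finset.mem_insert, Finset.mem_erase, key_lt_iff,
    Fin.lt_def, Fin.ext_iff]
  change (_ ∧ (e.1.1.1 < a.1.1.1 ∨ e.1.1.1 = a.1.1.1 ∧ e.1.2.1 < b.1.2.1)) ↔ _
  constructor
  · rintro ⟨rfl | ⟨_, h4, h5⟩, h6⟩
    · exfalso
      change a.1.1.1 < a.1.1.1 ∨ a.1.1.1 = a.1.1.1 ∧ b.1.2.1 < b.1.2.1 at h6
      omega
    · rcases h6 with h6 | h6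
      · exact ⟨h5, Or.inl h6⟩
      · exact absurd (hu e h5 h6.1) h4
  · rintro ⟨h3, h4⟩
    have h5 : e.1.1.1 < a.1.1.1 := by
      rcases h4 with h4 | h4
      · exact h4
      · rw [hu e h3 h4.1] at h4
        omega
    refine ⟨Or.inr ⟨?_, ?_, h3⟩, Or.inl h5⟩ <;> rintro rfl <;> omega

lemma term_one {a b : P n} (h : a.1.2 = b.1.1) (hu : ∀ e ∈ N, e.1.1.1 = a.1.1.1 → e = a) :
    term (fun _ => 1) N a b = (-1) ^ pos N b := by
  rw [term_of_comp h (comp_notMem_of_unique h hu), sgn, pos_comp h hu, mul_one, pow_add, pow_add]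
  have : ((-1 : ℤ) ^ pos N a) * (-1) ^ pos N a = 1 := by
    rw [← pow_add, ← two_mul, pow_mul]; simp
  linear_combination (-1 : ℤ) ^ pos N b * this

lemma tr_one_wheel (hn : q + 2 ≤ n) :
    tr (fun _ => 1) (wheel hn) = (-1) ^ pos (wheel hn) (axle hn) * q := by
  have hax : axle hn ∉ spokes q n := by
    rw [mem_spokes]
    intro h
    have : q + 1 = q := h
    omega
  have h1 : ∀ a ∈ wheel hn, ∑ b ∈ wheel hn, term (fun _ => 1) (wheel hn) a b =
      term (fun _ => 1) (wheel hn) a (axle hn) := by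
    intro a ha
    refine Finset.sum_eq_single _ (fun b hb hne => ?_) (fun h => absurd (axle_mem_wheel hn) h)
    by_contra ht
    obtain ⟨h, _⟩ := exists_of_term_ne_zero ht
    have h' : a.1.2.1 = b.1.1.1 := congrArg Fin.val h
    have h2 := (mem_wheel.1 hb).resolve_left hne
    have h3 := P_lt b
    rcases mem_wheel.1 ha with rfl | h4
    · have : q + 1 = b.1.1.1 := h'
      omega
    · omega
  rw [tr, Finset.sum_congr rfl h1]
  conv_lhs => rw [wheel]
  rw [Finset.sum_insert hax]
  have h2 : term (fun _ => 1) (insert (axle hn) (spokes q n)) (axle hn) (axle hn) = 0 := by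
    rw [term, dif_neg]
    intro h
    have : q + 1 = q := congrArg Fin.val h
    omega
  have h3 : ∀ a ∈ spokes q n, term (fun _ => 1) (wheel hn) a (axle hn) =
      (-1) ^ pos (wheel hn) (axle hn) := by
    intro a ha
    rw [mem_spokes] at ha
    refine term_one (Fin.ext ha) fun e he h => ?_
    rcases mem_wheel.1 he with rfl | h'
    · have : q = a.1.1.1 := h
      have := P_lt a
      omega
    · exact P_ext h (h'.trans ha.symm)
  rw [h2, zero_add]
  change ∑ a ∈ spokes q n, term (fun _ => 1) (wheel hn) a (axle hn) = _
  rw [Finset.sum_congr rfl h3, Finset.sum_const, card_spokes hn, nsmul_eq_mul, mul_comm]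

lemma pos_eq_succ {x : ℕ} {b b' : P n} (h : outE N x = {b, b'}) (hlt : b.1.2.1 < b'.1.2.1) :
    pos N b' = pos N b + 1 := by
  have hmem : ∀ e, (e ∈ N ∧ e.1.1.1 = x) ↔ e = b ∨ e = b' := by
    intro e
    rw [← mem_outE, h, Finset.mem_insert, Finset.mem_singleton]
  obtain ⟨hb, hbx⟩ := (hmem b).2 (Or.inl rfl)
  obtain ⟨hb', hbx'⟩ := (hmem b').2 (Or.inr rfl)
  have : (N.filter fun e => key e < key b') = insert b (N.filter fun e => key e < key b) := by
    ext e
    simp only [Finset.mem_filter, Finset.mem_insert, key_lt_iff]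
    constructor
    · rintro ⟨h1, h2 | h2⟩
      · exact Or.inr ⟨h1, Or.inl (by omega)⟩
      · rcases (hmem e).1 ⟨h1, by omega⟩ with rfl | rfl
        · exact Or.inl rfl
        · omega
    · rintro (rfl | ⟨h1, h2⟩)
      · exact ⟨hb, by omega⟩
      · exact ⟨h1, by omega⟩
  rw [pos, this, Finset.card_insert_of_notMem (by simp)]
  rfl

lemma tr_one_eq_zero (hn : q + 2 ≤ n) (hN : wt N = wqn q n) (hax : axle hn ∉ N)
    (hc : N.card = q + 1) : tr (fun _ => 1) N = 0 := by
  have h1 : (inner q N).card = 1 := by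
    have h1 := card_eq hn hN
    rw [outE_hub_of_notMem hn hN hax] at h1
    omega
  obtain ⟨a, ha⟩ := Finset.card_eq_one.1 h1
  have hmem : ∀ e, (e ∈ N ∧ e.1.2.1 < q) ↔ e = a := by
    intro e
    rw [← mem_inner, ha, Finset.mem_singleton]
  obtain ⟨haN, haq⟩ := (hmem a).2 rfl
  have hlt := P_lt a
  have h2 : (outE N a.1.2.1).card = 2 := by
    rw [card_outE_of_lt hn hN haq]
    have : inE N a.1.2.1 = {a} := by
      ext e
      rw [mem_inE, Finset.mem_singleton]
      exact ⟨fun h => (hmem e).1 ⟨h.1, by omega⟩, fun h => ⟨h ▸ haN, by rw [h]⟩⟩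
    rw [this]; rfl
  have h3 : (outE N a.1.1.1).card = 1 := by
    rw [card_outE_of_lt hn hN (by omega)]
    have : inE N a.1.1.1 = ∅ := by
      ext e
      simp only [mem_inE, Finset.notMem_empty, iff_false, not_and]
      intro he h
      have := (hmem e).1 ⟨he, by omega⟩
      rw [this] at h
      omega
    rw [this]; rfl
  have hu : ∀ e ∈ N, e.1.1.1 = a.1.1.1 → e = a := fun e he h =>
    Finset.card_le_one.1 h3.le e (mem_outE.2 ⟨he, h⟩) a (mem_outE.2 ⟨haN, rfl⟩)
  obtain ⟨b, b', hne, hout⟩ := Finset.card_eq_two.1 h2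
  wlog hbb : b.1.2.1 < b'.1.2.1 generalizing b b'
  · have hb : b ∈ outE N a.1.2.1 := by simp [hout]
    have hb' : b' ∈ outE N a.1.2.1 := by simp [hout]
    rw [mem_outE] at hb hb'
    refine this b' b hne.symm (by rw [hout, Finset.pair_comm]) ?_
    have : b.1.2.1 ≠ b'.1.2.1 := fun h => hne (P_ext (by omega) h)
    omega
  have h4 : ∀ a' ∈ N, a' ≠ a → ∑ c ∈ N, term (fun _ => 1) N a' c = 0 := by
    intro a' ha' hne'
    refine Finset.sum_eq_zero fun c hc' => ?_
    by_contra ht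
    obtain ⟨h, _⟩ := exists_of_term_ne_zero ht
    have h5 : a'.1.2.1 = c.1.1.1 := congrArg Fin.val h
    have h6 := P_lt c
    have h7 := snd_le hn hN hc'
    have h8 : ¬ a'.1.2.1 < q := fun h8 => hne' ((hmem a').1 ⟨ha', h8⟩)
    exact hax (mem_outE_hub hn hN hc' (by omega) ▸ hc')
  rw [tr, Finset.sum_eq_single a h4 (fun h => absurd haN h),
    ← Finset.sum_subset (show outE N a.1.2.1 ⊆ N from Finset.filter_subset _ N), hout,
    Finset.sum_pair hne]
  · have hb : b ∈ outE N a.1.2.1 := by simp [hout]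
    have hb' : b' ∈ outE N a.1.2.1 := by simp [hout]
    rw [mem_outE] at hb hb'
    rw [term_one (Fin.ext hb.2.symm) hu, term_one (Fin.ext hb'.2.symm) hu, pos_eq_succ hout hbb,
      pow_succ]
    ring
  · intro c hcN hc'
    by_contra ht
    obtain ⟨h, _⟩ := exists_of_term_ne_zero ht
    exact hc' (mem_outE.2 ⟨hcN, congrArg Fin.val h.symm⟩)

lemma dvd_tr_one (hn : q + 2 ≤ n) (hN : wt N = wqn q n) (hc : N.card = q + 1) :
    (q : ℤ) ∣ tr (fun _ => 1) N := by
  by_cases h : axle hn ∈ N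
  · rw [eq_wheel hn hN h, tr_one_wheel]
    exact Dvd.intro_left _ rfl
  · rw [tr_one_eq_zero hn hN h hc]
    exact dvd_zero _

end

/-! ### Homology of the summand -/

section

variable {k : ℤ}

lemma exists_dW_eq (hn : q + 2 ≤ n) (hq : 0 < q) (z : Cw n k (wqn q n)) :
    ∃ u : Cw n (k + 1) (wqn q n), (∀ N, spoke₀ hn hq ∈ N.1 → u N = 0) ∧
      ∀ M : Bw n k (wqn q n), spoke₀ hn hq ∈ M.1 → axle hn ∉ M.1 →
        dW n k (wqn q n) u M = z M := by
  classical
  let u : Cw n (k + 1) (wqn q n) := Finsupp.equivFunOnFinite.symm fun N =>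
    ∑ M : Bw n k (wqn q n), if Matched hn hq N.1 M.1 then z M * tr (Pi.single M.1 1) N.1 else 0
  have hu : ∀ N, u N = ∑ M : Bw n k (wqn q n),
      if Matched hn hq N.1 M.1 then z M * tr (Pi.single M.1 1) N.1 else 0 := fun N => rfl
  have hu0 : ∀ N, u N ≠ 0 → ∃ M, Matched hn hq N.1 M := by
    intro N h
    rw [hu] at h
    obtain ⟨M, _, h⟩ := Finset.exists_ne_zero_of_sum_ne_zero h
    split_ifs at h with h1
    · exact ⟨M.1, h1⟩
    · exact absurd rfl h
  refine ⟨u, fun N hN => ?_, fun M hM hax => ?_⟩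
  · by_contra h
    obtain ⟨M, h1⟩ := hu0 N h
    exact h1.notMem hN
  · obtain ⟨N, hNM⟩ := exists_matched_left hn hq M.2.2 hM hax
    let N₀ : Bw n (k + 1) (wqn q n) := ⟨N, by
      have := hNM.card_eq
      have := M.2.1
      push_cast [← hNM.card_eq]
      omega, hNM.wt_eq.symm.trans M.2.2⟩
    rw [← evW_delta, evW_dW, evW_eq_sum, Finset.sum_eq_single N₀, hu,
      Finset.sum_eq_single M, if_pos hNM, mul_assoc, hNM.tr_mul_self N₀.2.2, mul_one]
    · intro M' _ hne
      rw [if_neg]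
      exact fun h => hne (Subtype.ext (h.right_unique N₀.2.2 hNM))
    · simp
    · intro N' _ hne
      by_contra h
      obtain ⟨M', h1⟩ := hu0 N' (left_ne_zero_of_mul h)
      have h2 := matched_of_tr_ne_zero h1.notMem hM (right_ne_zero_of_mul h)
      exact hne (Subtype.ext (h2.left_unique M.2.2 hNM))
    · simp

lemma eq_zero_of_mem_ZW (hn : q + 2 ≤ n) (hq : 0 < q) (hk : k ≠ q) {z : Cw n k (wqn q n)}
    (hz : z ∈ ZW n k (wqn q n)) (h : ∀ M, spoke₀ hn hq ∈ M.1 → z M = 0) : z = 0 := by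
  ext N
  by_cases h0 : spoke₀ hn hq ∈ N.1
  · exact h N h0
  · obtain ⟨M, hM⟩ := exists_matched_right hn hq N.2.2 h0
      fun h' => hk (by rw [← N.2.1, h'])
    have h1 := mem_ZW_iff.1 hz (Pi.single M 1)
    rw [evW_eq_sum, Finset.sum_eq_single N] at h1
    · have h2 := hM.tr_mul_self N.2.2
      rw [Finsupp.zero_apply]
      linear_combination tr (Pi.single M 1) N.1 * h1 - z N * h2
    · intro N' _ hne
      by_contra h'
      have h2 : spoke₀ hn hq ∉ N'.1 := fun h2 => left_ne_zero_of_mul h' (h N' h2)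
      have h3 := matched_of_tr_ne_zero h2 hM.mem (right_ne_zero_of_mul h')
      exact hne (Subtype.ext (h3.left_unique (hM.wt_eq.trans N.2.2) hM))
    · simp

lemma evW_tr_one (hn : q + 2 ≤ n) (z : Cw n k (wqn q n)) {M : Bw n k (wqn q n)}
    (hM : axle hn ∈ M.1) :
    evW k (wqn q n) (tr fun _ => 1) z = z M * ((-1) ^ pos (wheel hn) (axle hn) * q) := by
  rw [evW_eq_sum, Finset.sum_eq_single M, eq_wheel hn M.2.2 hM, tr_one_wheel]
  · intro N _ hne
    rw [tr_one_eq_zero hn N.2.2, mul_zero]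
    · intro h
      exact hne (Subtype.ext ((eq_wheel hn N.2.2 h).trans (eq_wheel hn M.2.2 hM).symm))
    · have h1 := card_of_axle hn M.2.2 hM
      have h2 := M.2.1
      have h3 := N.2.1
      omega
  · simp

/-- The homology of `⟦w⟧` vanishes away from degree `q`. -/
theorem subsingleton_Hw (hn : q + 2 ≤ n) (hq : 0 < q) (hk : k ≠ q) :
    Subsingleton (Hw n k (wqn q n)) := by
  refine Submodule.Quotient.subsingleton_iff.2 (eq_top_iff.2 fun z _ => ?_)
  rw [mem_HwSub_iff]
  obtain ⟨u, -, hu⟩ := exists_dW_eq hn hq z.1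
  refine ⟨u, ?_⟩
  have hz : z.1 - dW n k (wqn q n) u ∈ ZW n k (wqn q n) :=
    Submodule.sub_mem _ z.2 (dW_mem_ZW _ _ _)
  refine (sub_eq_zero.1 (eq_zero_of_mem_ZW hn hq hk hz fun M hM => ?_)).symm
  by_cases hax : axle hn ∈ M.1
  · have h1 := mem_ZW_iff.1 hz fun _ => 1
    rw [evW_tr_one hn _ hax] at h1
    refine (mul_eq_zero.1 h1).resolve_right ?_
    simp [hq.ne']
  · rw [Finsupp.sub_apply, hu M hM hax, sub_self]

lemma mem_ZW_self (hn : q + 2 ≤ n) (z : Cw n q (wqn q n)) : z ∈ ZW n q (wqn q n) := by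
  rw [ZW, LinearMap.mem_ker]
  ext M
  have h1 := le_card hn M.2.2
  have h2 := M.2.1
  omega

lemma eq_single_of_vanish (hn : q + 2 ≤ n) (hq : 0 < q) {M : Bw n q (wqn q n)}
    (hM : spoke₀ hn hq ∉ M.1) {z : Cw n q (wqn q n)} (hz : ∀ N, spoke₀ hn hq ∈ N.1 → z N = 0) :
    z = Finsupp.single M (evW q (wqn q n) (fun _ => 1) z) := by
  have h1 : ∀ N, N ≠ M → z N = 0 := by
    intro N hne
    refine hz N ?_
    by_contra h0
    refine hne (Subtype.ext (Finset.ext fun p => ?_))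
    rw [mem_iff_of_card hn hq N.2.2 h0 (by exact_mod_cast N.2.1),
      mem_iff_of_card hn hq M.2.2 hM (by exact_mod_cast M.2.1)]
  have h2 : evW q (wqn q n) (fun _ => 1) z = z M := by
    rw [evW_eq_sum, Finset.sum_eq_single M]
    · simp
    · intro N _ hne
      rw [h1 N hne, zero_mul]
    · simp
  ext N
  rw [h2]
  by_cases h : N = M
  · simp [h]
  · rw [h1 N h, Finsupp.single_eq_of_ne h]

lemma exists_dW_add_single (hn : q + 2 ≤ n) (hq : 0 < q) {M : Bw n q (wqn q n)}
    (hM : spoke₀ hn hq ∉ M.1) (z : Cw n q (wqn q n)) :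
    ∃ u : Cw n (q + 1) (wqn q n), (∀ N, spoke₀ hn hq ∈ N.1 → u N = 0) ∧
      z = dW n q (wqn q n) u + Finsupp.single M (evW q (wqn q n) (fun _ => 1) z -
        evW (q + 1) (wqn q n) (tr fun _ => 1) u) := by
  obtain ⟨u, hu, hdu⟩ := exists_dW_eq hn hq z
  refine ⟨u, hu, ?_⟩
  rw [← evW_dW, ← map_sub, ← eq_single_of_vanish hn hq hM]
  · abel
  · intro N hN
    rw [Finsupp.sub_apply, hdu N hN, sub_self]
    intro hax
    have h1 := card_of_axle hn N.2.2 hax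
    have h2 := N.2.1
    omega

lemma exists_dW_eq_single (hn : q + 2 ≤ n) (hq : 0 < q) {M : Bw n q (wqn q n)}
    (hM : spoke₀ hn hq ∉ M.1) :
    ∃ u, dW n q (wqn q n) u = Finsupp.single M (q : ℤ) := by
  let W : Bw n (q + 1) (wqn q n) :=
    ⟨wheel hn, by rw [card_wheel]; push_cast; rfl, wt_wheel hn⟩
  have hW : axle hn ∈ W.1 := axle_mem_wheel hn
  obtain ⟨u, hu, hdu⟩ := exists_dW_add_single hn hq hM (dW n q (wqn q n) (Finsupp.single W 1))
  have h1 : u W = 0 := hu W (mem_wheel.2 (Or.inr rfl))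
  rw [evW_dW, evW_tr_one hn _ hW, evW_tr_one hn _ hW, h1, Finsupp.single_eq_same, one_mul,
    zero_mul, sub_zero] at hdu
  refine ⟨(-1 : ℤ) ^ pos (wheel hn) (axle hn) • (Finsupp.single W 1 - u), ?_⟩
  rw [map_smul, map_sub, hdu, add_sub_cancel_left, Finsupp.smul_single, smul_eq_mul, ← mul_assoc,
    ← pow_add, ← two_mul, pow_mul]
  simp

lemma dvd_evW_tr_one (hn : q + 2 ≤ n) (u : Cw n (q + 1) (wqn q n)) :
    (q : ℤ) ∣ evW (q + 1) (wqn q n) (tr fun _ => 1) u := by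
  rw [evW_eq_sum]
  exact Finset.dvd_sum fun N _ =>
    Dvd.dvd.mul_left (dvd_tr_one hn N.2.2 (by exact_mod_cast N.2.1)) _

/-- The homology of `⟦w⟧` in degree `q`. -/
theorem nonempty_Hw_equiv_zmod (hn : q + 2 ≤ n) (hq : 0 < q) :
    Nonempty (Hw n q (wqn q n) ≃ₗ[ℤ] ZMod q) := by
  obtain ⟨M, hM, hMc, h0⟩ := exists_exceptional hn hq
  let M₀ : Bw n q (wqn q n) := ⟨M, by rw [hMc], hM⟩
  have hM₀ : spoke₀ hn hq ∉ M₀.1 := h0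
  let φ : ZW n q (wqn q n) →ₗ[ℤ] ZMod q := (Int.castAddHom (ZMod q)).toIntLinearMap ∘ₗ
    evW q (wqn q n) (fun _ => 1) ∘ₗ (ZW n q (wqn q n)).subtype
  have hφ : ∀ z, φ z = (evW q (wqn q n) (fun _ => 1) z.1 : ZMod q) := fun z => rfl
  have hsurj : Function.Surjective φ := by
    intro x
    obtain ⟨r, rfl⟩ := ZMod.intCast_surjective x
    refine ⟨⟨Finsupp.single M₀ r, mem_ZW_self hn _⟩, ?_⟩
    rw [hφ, evW_single, mul_one]
  have hker : HwSub n q (wqn q n) = LinearMap.ker φ := by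
    ext z
    rw [mem_HwSub_iff, LinearMap.mem_ker, hφ, ZMod.intCast_zmod_eq_zero_iff_dvd]
    constructor
    · rintro ⟨u, hu⟩
      rw [← hu, evW_dW]
      exact dvd_evW_tr_one hn u
    · intro h
      obtain ⟨u, -, hu⟩ := exists_dW_add_single hn hq hM₀ z.1
      obtain ⟨v, hv⟩ := exists_dW_eq_single hn hq hM₀
      obtain ⟨c, hc⟩ := dvd_sub h (dvd_evW_tr_one hn u)
      refine ⟨u + c • v, ?_⟩
      rw [map_add, map_smul, hv, Finsupp.smul_single, smul_eq_mul, mul_comm c, ← hc, ← hu]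
  exact ⟨(Submodule.quotEquivOfEq _ _ hker).trans (φ.quotKerEquivOfSurjective hsurj)⟩

end

/-- Example 3.6: for a prime power `q = p^m` and `n = q + 2`, `w = (2,3,…,q+1,2,q+1)`,
one has `H_q⟦w⟧ ≅ ℤ/q` and `H_k⟦w⟧ = 0` for `k ≠ q`; consequently for every `n` with
`p^m < n - 1`, `H_{p^m}(nil_n; ℤ)` contains a direct summand isomorphic to `ℤ/p^m`. -/
theorem prime_power_summand (p m : ℕ) (hp : p.Prime) (hm : 1 ≤ m) :
    (Nonempty (Hw (p ^ m + 2) (p ^ m : ℤ) (wq (p ^ m)) ≃ₗ[ℤ] ZMod (p ^ m)) ∧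
      ∀ k : ℤ, k ≠ (p ^ m : ℤ) → Subsingleton (Hw (p ^ m + 2) k (wq (p ^ m)))) ∧
    ∀ n : ℕ, p ^ m < n - 1 →
      ∃ (A B : Submodule ℤ (Hnil n (p ^ m : ℤ))),
        IsCompl A B ∧ Nonempty (A ≃ₗ[ℤ] ZMod (p ^ m)) := by
  have hq : 0 < p ^ m := pow_pos hp.pos m
  have hcast : ((p : ℤ) ^ m) = ((p ^ m : ℕ) : ℤ) := by push_cast; rfl
  rw [hcast, ← wqn_add_two]
  refine ⟨⟨nonempty_Hw_equiv_zmod le_rfl hq, fun k hk => subsingleton_Hw le_rfl hq hk⟩,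
    fun n hn => ?_⟩
  obtain ⟨A, B, hAB, ⟨e⟩⟩ := exists_summand_equiv_Hw n ((p ^ m : ℕ) : ℤ) (wqn (p ^ m) n)
  obtain ⟨e'⟩ := nonempty_Hw_equiv_zmod (show p ^ m + 2 ≤ n by omega) hq
  exact ⟨A, B, hAB, ⟨e.trans e'⟩⟩

end Nil
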